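/- arXiv:0801.0586 — 4 statements merged into one kernel-verified Lean document; each statement's English description precedes it below -/
import Mathlib

section
/- Let n ≥ 3 and 2 ≤ s ≤ n−1, r = s+n−1, let d_1,…,d_r be positive integers and d a positive integer with d ≥ d_i for all i. For 1 ≤ i ≤ s define g_i(x) = ∏_{j=1}^{d_i} (x_i − j). For s+1 ≤ i ≤ r and 1 ≤ j ≤ d_i define the affine-linear forms φ_{ij}(x) = (∑_{k=s+1}^{n} x_k / ((i−s−1)d + j−1 + k−s)) + 1/((i−s−1)d + j−1 + n+1−s), and the linear form ψ_i(μ) = ∑_{k=1}^{s} μ_k/(i−s−1+k), and set g_i(x,μ) = (∏_{j=1}^{d_i} φ_{ij}(x)) · ψ_i(μ). Then the polynomial system g_1(x) = … = g_s(x) = 0, g_{s+1}(x, μ_1,…,μ_{s−1}, 1) = … = g_r(x, μ_1,…,μ_{s−1}, 1) = 0 has exactly D := (∏_{i=1}^{s} d_i) · (∑_{E ⊆ {s+1,…,r}, #E = n−s} ∏_{j∈E} d_j) solutions (x, μ) ∈ ℂⁿ × ℂ^{s−1}; any two distinct solutions have distinct x-components; and at every solution, the Jacobian determinant of these r polynomials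 with respect to the variables (x_1,…,x_n, μ_1,…,μ_{s−1}) is nonzero. -/
open MvPolynomial

/-- The type 1 initial system: a family of `r = s+n-1` polynomials in the
`r` variables `x_1,…,x_n, μ_1,…,μ_{s-1}` (the variable of index `j < n` is `x_{j+1}`,
and the variable of index `n + k` is `μ_{k+1}`; `μ_s` has been substituted by `1`).
For `i < s` the polynomial is `∏_{j=1}^{d_i} (x_{i+1} - j)`, and for `s ≤ i < r` it is
`(∏_{j=1}^{d_i} φ_{ij}) ψ_i` as in the paper. -/
noncomputable def typeOneSystem (n s : ℕ) (hs : 2 ≤ s) (hsn : s ≤ n - 1)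
    (d : Fin (s + n - 1) → ℕ) (dm : ℕ) :
    Fin (s + n - 1) → MvPolynomial (Fin (s + n - 1)) ℂ := fun i =>
  if (i : ℕ) < s then
    ∏ j ∈ Finset.range (d i), (X i - C ((j : ℂ) + 1))
  else
    (∏ j ∈ Finset.range (d i),
      ((∑ b : Fin (n - s),
          C ((((i : ℕ) - s) * dm + j + (b : ℕ) + 1 : ℕ) : ℂ)⁻¹ *
            X (⟨s + (b : ℕ), by have := b.isLt; omega⟩ : Fin (s + n - 1)))
        + C ((((i : ℕ) - s) * dm + j + (n - s) + 1 : ℕ) : ℂ)⁻¹))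
    * ((∑ k : Fin (s - 1),
          C ((((i : ℕ) - s) + (k : ℕ) + 1 : ℕ) : ℂ)⁻¹ *
            X (⟨n + (k : ℕ), by have := k.isLt; omega⟩ : Fin (s + n - 1)))
        + C ((((i : ℕ) - s) + s : ℕ) : ℂ)⁻¹)

open Finset in
/-- Cauchy matrices `(a + b + 1)⁻¹` with distinct row parameters have trivial kernel. -/
theorem eq_zero_of_cauchy_sum_eq_zero (k : ℕ) (y : ℕ → ℂ) (A : Finset ℕ) (hA : k ≤ #A)
    (h : ∀ a ∈ A, ∑ b ∈ range k, ((a + b + 1 : ℕ) : ℂ)⁻¹ * y b = 0) :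
    ∀ b < k, y b = 0 := by
  classical
  set P : Polynomial ℂ := ∑ b ∈ range k, Polynomial.C (y b) *
    ∏ c ∈ (range k).erase b, (Polynomial.X + Polynomial.C ((c : ℂ) + 1)) with hP
  have hev : ∀ z, P.eval z = ∑ b ∈ range k, y b * ∏ c ∈ (range k).erase b, (z + (c + 1)) := by
    intro z
    simp [hP, Polynomial.eval_finsetSum, Polynomial.eval_prod]
  have hP0 : P = 0 := by
    rcases Nat.eq_zero_or_pos k with rfl | hk
    · simp [hP]
    refine Polynomial.eq_zero_of_degree_lt_of_eval_finset_eq_zero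
      (A.map ⟨((↑) : ℕ → ℂ), Nat.cast_injective⟩) ?_ ?_
    · rw [card_map]
      refine lt_of_lt_of_le ?_ (Nat.cast_le.mpr hA)
      refine (Polynomial.degree_sum_le _ _).trans_lt ?_
      refine (Finset.sup_lt_iff (WithBot.bot_lt_coe k)).mpr fun b hb => ?_
      rw [← Polynomial.smul_eq_C_mul]
      refine (Polynomial.degree_smul_le _ _).trans_lt ?_
      refine (Polynomial.degree_prod_le _ _).trans_lt ?_
      rw [sum_congr rfl fun (c : ℕ) _ => Polynomial.degree_X_add_C ((c : ℂ) + 1)]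
      rw [sum_const, card_erase_of_mem hb, card_range, nsmul_one]
      exact WithBot.coe_lt_coe.mpr (Nat.sub_lt hk one_pos)
    · intro z hz
      obtain ⟨a, ha, rfl⟩ := mem_map.mp hz
      have hne : ∀ c : ℕ, (a : ℂ) + (c + 1) ≠ 0 := fun c => by
        exact_mod_cast Nat.succ_ne_zero (a + c)
      have h1 := congrArg (fun t => (∏ c ∈ range k, ((a : ℂ) + (c + 1))) * t) (h a ha)
      simp only [mul_zero, mul_sum] at h1
      rw [hev, ← h1]
      refine sum_congr rfl fun b hb => ?_
      rw [← mul_prod_erase _ _ hb]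
      have := hne b
      simp only [Function.Embedding.coeFn_mk]
      push_cast
      rw [add_assoc (a : ℂ)]
      field_simp
  intro b hb
  have h2 := hev (-((b : ℂ) + 1))
  rw [hP0, Polynomial.eval_zero, sum_eq_single_of_mem b (mem_range.mpr hb)] at h2
  · refine (mul_eq_zero.mp h2.symm).resolve_right (prod_ne_zero_iff.mpr fun c hc => ?_)
    have hcb := (mem_erase.mp hc).1
    intro h3
    apply hcb
    have : (c : ℂ) = b := by linear_combination h3
    exact_mod_cast this
  · intro c _ hcb
    rw [prod_eq_zero (i := b), mul_zero]
    · simp [hb, hcb.symm]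
    · ring

/-- The affine-linear form `∑_{b < k} x_{o+b} / (a + b + 1) + 1 / (a + k + 1)`. -/
noncomputable def hilbertForm {r : ℕ} (o k : ℕ) (h : o + k ≤ r) (a : ℕ) :
    MvPolynomial (Fin r) ℂ :=
  (∑ b : Fin k, C ((a + (b : ℕ) + 1 : ℕ) : ℂ)⁻¹ * X (⟨o + (b : ℕ), by omega⟩ : Fin r))
    + C ((a + k + 1 : ℕ) : ℂ)⁻¹

/-- The coefficient of the variable `j` in `hilbertForm o k h a`. -/
noncomputable def hilbertCoeff {r : ℕ} (o k a : ℕ) (j : Fin r) : ℂ :=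
  if o ≤ (j : ℕ) ∧ (j : ℕ) < o + k then ((a + (j - o) + 1 : ℕ) : ℂ)⁻¹ else 0

theorem hilbertCoeff_dotProduct {r : ℕ} (o k a : ℕ) (h : o + k ≤ r) (v : Fin r → ℂ) :
    hilbertCoeff o k a ⬝ᵥ v =
      ∑ b : Fin k, ((a + (b : ℕ) + 1 : ℕ) : ℂ)⁻¹ * v ⟨o + (b : ℕ), by omega⟩ := by
  symm
  refine Finset.sum_of_injOn (fun b : Fin k => (⟨o + (b : ℕ), by omega⟩ : Fin r)) ?_ ?_ ?_ ?_
  · intro b _ c _ hbc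
    simp only [Fin.mk.injEq] at hbc
    exact Fin.ext (by omega)
  · simp [Set.MapsTo]
  · intro j _ hj
    rw [hilbertCoeff, if_neg, zero_mul]
    rintro ⟨h1, h2⟩
    refine hj ⟨⟨j - o, by omega⟩, by simp, Fin.ext ?_⟩
    simp only
    omega
  · intro b _
    rw [hilbertCoeff, if_pos ⟨by simp, by simp⟩]
    simp

theorem eval_hilbertForm {r : ℕ} (o k a : ℕ) (h : o + k ≤ r) (p : Fin r → ℂ) :
    eval p (hilbertForm o k h a) = hilbertCoeff o k a ⬝ᵥ p + ((a + k + 1 : ℕ) : ℂ)⁻¹ := by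
  rw [hilbertCoeff_dotProduct o k a h, hilbertForm]
  simp only [map_add, map_sum, map_mul, eval_C, eval_X]

theorem pderiv_hilbertForm {r : ℕ} (o k a : ℕ) (h : o + k ≤ r) (j : Fin r) :
    pderiv j (hilbertForm o k h a) = C (hilbertCoeff o k a j) := by
  have h1 := hilbertCoeff_dotProduct o k a h (Pi.single j 1)
  rw [dotProduct_single, mul_one] at h1
  rw [h1, hilbertForm]
  simp only [map_add, map_sum, pderiv_C_mul, pderiv_C, add_zero, map_mul, pderiv_X]
  refine Finset.sum_congr rfl fun b _ => ?_
  simp only [Pi.single_apply, eq_comm, apply_ite C, map_one, map_zero]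

/-- A point is a zero of at most `k` of the forms `hilbertForm o k h a`. -/
theorem card_le_of_eval_hilbertForm_eq_zero {r : ℕ} (o k : ℕ) (h : o + k ≤ r) (p : Fin r → ℂ)
    (A : Finset ℕ) (hA : ∀ a ∈ A, eval p (hilbertForm o k h a) = 0) : A.card ≤ k := by
  by_contra! hlt
  have := eq_zero_of_cauchy_sum_eq_zero (k + 1)
    (fun b => if hb : b < k then p ⟨o + b, by omega⟩ else 1) A hlt (fun a ha => ?_) k (by omega)
  · simp at this
  · rw [← hA a ha, eval_hilbertForm, hilbertCoeff_dotProduct o k a h, Finset.sum_range_succ,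
      Finset.sum_range]
    simp

theorem eq_zero_of_hilbertCoeff_dotProduct_eq_zero {r : ℕ} (o k : ℕ) (h : o + k ≤ r)
    (v : Fin r → ℂ) (A : Finset ℕ) (hc : k ≤ A.card)
    (hA : ∀ a ∈ A, hilbertCoeff o k a ⬝ᵥ v = 0) (j : Fin r) (hj : o ≤ (j : ℕ))
    (hj' : (j : ℕ) < o + k) : v j = 0 := by
  have := eq_zero_of_cauchy_sum_eq_zero k
    (fun b => if hb : b < k then v ⟨o + b, by omega⟩ else 1) A hc (fun a ha => ?_) (j - o)
    (by omega)
  · rw [dif_pos (by omega)] at this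
    convert this using 2
    exact Fin.ext (by simp only; omega)
  · rw [← hA a ha, hilbertCoeff_dotProduct o k a h, Finset.sum_range]
    simp

namespace TypeOne

variable {n s : ℕ} (hs : 2 ≤ s) (hsn : s ≤ n - 1)
  (d : Fin (s + n - 1) → ℕ) (dm : ℕ)

/-- The factor `φ_{ij}`. -/
noncomputable def phi (i : Fin (s + n - 1)) (j : ℕ) : MvPolynomial (Fin (s + n - 1)) ℂ :=
  hilbertForm s (n - s) (by omega) (((i : ℕ) - s) * dm + j)

/-- The factor `ψ_i`, dehomogenized. -/
noncomputable def psi (i : Fin (s + n - 1)) : MvPolynomial (Fin (s + n - 1)) ℂ :=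
  hilbertForm n (s - 1) (by omega) ((i : ℕ) - s)

theorem typeOneSystem_of_lt {i : Fin (s + n - 1)} (hi : (i : ℕ) < s) :
    typeOneSystem n s hs hsn d dm i = ∏ j ∈ Finset.range (d i), (X i - C ((j : ℂ) + 1)) := by
  rw [typeOneSystem, if_pos hi]

theorem typeOneSystem_of_le {i : Fin (s + n - 1)} (hi : s ≤ (i : ℕ)) :
    typeOneSystem n s hs hsn d dm i =
      (∏ j ∈ Finset.range (d i), phi hs hsn dm i j) * psi hs i := by
  rw [typeOneSystem, if_neg (by omega)]
  have : (i : ℕ) - s + (s - 1) + 1 = (i : ℕ) - s + s := by omega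
  simp only [phi, psi, hilbertForm, this]

/-- The indices of the equations involving `μ`. -/
def upper (n s : ℕ) : Finset (Fin (s + n - 1)) :=
  Finset.univ.filter fun i => s ≤ (i : ℕ)

theorem mem_upper {i : Fin (s + n - 1)} : i ∈ upper n s ↔ s ≤ (i : ℕ) := by simp [upper]

include hs hsn in
theorem card_upper : (upper n s).card = n - 1 := by
  have h : upper n s = Finset.univ.image
      fun b : Fin (n - 1) => (⟨s + b, by omega⟩ : Fin (s + n - 1)) := by
    ext i
    simp only [mem_upper, Finset.mem_image, Finset.mem_univ, true_and]
    constructor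
    · intro hi
      exact ⟨⟨i - s, by omega⟩, Fin.ext (by simp only; omega)⟩
    · rintro ⟨b, rfl⟩
      simp
  rw [h, Finset.card_image_of_injective, Finset.card_univ, Fintype.card_fin]
  intro b c hbc
  simp only [Fin.mk.injEq] at hbc
  exact Fin.ext (by omega)

/-- The choices of one linear factor in every equation: the set `E` of indices where some `φ` is
chosen, and the number `c i` of the factor of the equation `i` (zero where `ψ_i` is chosen). -/
def choices (n s : ℕ) (d : Fin (s + n - 1) → ℕ) :
    Finset (Σ _ : Finset (Fin (s + n - 1)), Fin (s + n - 1) → ℕ) :=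
  (Finset.powersetCard (n - s) (upper n s)).sigma fun E =>
    Fintype.piFinset fun i => if (i : ℕ) < s ∨ i ∈ E then Finset.range (d i) else {0}

theorem mem_choices {E : Finset (Fin (s + n - 1))} {c : Fin (s + n - 1) → ℕ} :
    ⟨E, c⟩ ∈ choices n s d ↔ (∀ i ∈ E, s ≤ (i : ℕ)) ∧ E.card = n - s ∧
      (∀ i : Fin (s + n - 1), ((i : ℕ) < s ∨ i ∈ E) → c i < d i) ∧
      ∀ i : Fin (s + n - 1), s ≤ (i : ℕ) → i ∉ E → c i = 0 := by
  simp only [choices, Finset.mem_sigma, Finset.mem_powersetCard, Fintype.mem_piFinset,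
    Finset.subset_iff, mem_upper, and_assoc]
  refine and_congr_right fun _ => and_congr_right fun _ => ?_
  rw [← forall_and]
  refine forall_congr' fun i => ?_
  by_cases h1 : (i : ℕ) < s <;> by_cases h2 : i ∈ E <;> (simp [h1, h2]; try omega)

theorem card_choices :
    (choices n s d).card =
      (∏ i ∈ Finset.univ.filter (fun i : Fin (s + n - 1) => (i : ℕ) < s), d i) *
        ∑ E ∈ Finset.powersetCard (n - s) (upper n s), ∏ j ∈ E, d j := by
  rw [choices, Finset.card_sigma, Finset.mul_sum]
  refine Finset.sum_congr rfl fun E hE => ?_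
  rw [Fintype.card_piFinset, ← Finset.prod_union]
  · rw [← Finset.prod_subset (Finset.subset_univ _)]
    · refine Finset.prod_congr rfl fun i hi => ?_
      rw [if_pos (by simpa using hi), Finset.card_range]
    · intro i _ hi
      rw [if_neg (by simpa using hi), Finset.card_singleton]
  · rw [Finset.disjoint_left]
    intro i hi hiE
    have := mem_upper.mp ((Finset.mem_powersetCard.mp hE).1 hiE)
    simp at hi
    omega

/-- The chosen linear factor of the equation `i`. -/
noncomputable def factor (E : Finset (Fin (s + n - 1))) (c : Fin (s + n - 1) → ℕ)
    (i : Fin (s + n - 1)) : MvPolynomial (Fin (s + n - 1)) ℂ :=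
  if (i : ℕ) < s then X i - C ((c i : ℂ) + 1)
  else if i ∈ E then phi hs hsn dm i (c i) else psi hs i

/-- The matrix of the linear parts of the chosen factors. -/
noncomputable def factorMatrix (E : Finset (Fin (s + n - 1))) (c : Fin (s + n - 1) → ℕ) :
    Matrix (Fin (s + n - 1)) (Fin (s + n - 1)) ℂ := Matrix.of fun i =>
  if (i : ℕ) < s then Pi.single i 1
  else if i ∈ E then hilbertCoeff s (n - s) (((i : ℕ) - s) * dm + c i)
  else hilbertCoeff n (s - 1) ((i : ℕ) - s)

theorem pderiv_factor (E : Finset (Fin (s + n - 1))) (c : Fin (s + n - 1) → ℕ)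
    (i j : Fin (s + n - 1)) :
    pderiv j (factor hs hsn dm E c i) = C (factorMatrix dm E c i j) := by
  simp only [factor, factorMatrix, Matrix.of_apply]
  split_ifs
  · simp [pderiv_X, Pi.single_apply, apply_ite C, eq_comm]
  · rw [phi, pderiv_hilbertForm]
  · rw [psi, pderiv_hilbertForm]

theorem eval_factor (E : Finset (Fin (s + n - 1))) (c : Fin (s + n - 1) → ℕ)
    (i : Fin (s + n - 1)) (p : Fin (s + n - 1) → ℂ) :
    eval p (factor hs hsn dm E c i) =
      (factorMatrix dm E c).mulVec p i + eval 0 (factor hs hsn dm E c i) := by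
  simp only [factor, factorMatrix, Matrix.mulVec, Matrix.of_apply]
  split_ifs
  · simp [sub_eq_add_neg]
  · simp only [phi, eval_hilbertForm, dotProduct_zero, zero_add]
  · simp only [psi, eval_hilbertForm, dotProduct_zero, zero_add]

variable {d dm}

theorem mul_add_inj {i i' : Fin (s + n - 1)} {j j' : ℕ} (hi : s ≤ (i : ℕ)) (hi' : s ≤ (i' : ℕ))
    (hj : j < dm) (hj' : j' < dm)
    (h : ((i : ℕ) - s) * dm + j = ((i' : ℕ) - s) * dm + j') : i = i' ∧ j = j' := by
  have h1 := congrArg (· / dm) h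
  have h2 := congrArg (· % dm) h
  have hdm : 0 < dm := by omega
  simp only [Nat.mod_eq_of_lt hj, Nat.mod_eq_of_lt hj',
    mul_comm _ dm, Nat.mul_add_div hdm, Nat.div_eq_of_lt hj, Nat.div_eq_of_lt hj',
    Nat.mul_add_mod] at h1 h2
  exact ⟨Fin.ext (by omega), h2⟩

theorem card_image_mul_add {E : Finset (Fin (s + n - 1))} {c : Fin (s + n - 1) → ℕ}
    (hE : ∀ i ∈ E, s ≤ (i : ℕ)) (hc : ∀ i ∈ E, c i < dm) :
    (E.image fun i : Fin (s + n - 1) => ((i : ℕ) - s) * dm + c i).card = E.card :=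
  Finset.card_image_of_injOn fun i hi i' hi' h =>
    (mul_add_inj (hE i hi) (hE i' hi') (hc i hi) (hc i' hi') h).1

theorem card_image_sub {F : Finset (Fin (s + n - 1))} (hF : ∀ i ∈ F, s ≤ (i : ℕ)) :
    (F.image fun i : Fin (s + n - 1) => (i : ℕ) - s).card = F.card :=
  Finset.card_image_of_injOn fun i hi i' hi' h => by
    have h1 := hF i hi
    have h2 := hF i' hi'
    exact Fin.ext (by omega)

/-- At most `n - s` equations have a vanishing `φ`-factor. -/
theorem card_le_of_phi (p : Fin (s + n - 1) → ℂ) {E : Finset (Fin (s + n - 1))}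
    {c : Fin (s + n - 1) → ℕ} (hE : ∀ i ∈ E, s ≤ (i : ℕ)) (hc : ∀ i ∈ E, c i < dm)
    (h : ∀ i ∈ E, eval p (phi hs hsn dm i (c i)) = 0) : E.card ≤ n - s := by
  rw [← card_image_mul_add hE hc]
  refine card_le_of_eval_hilbertForm_eq_zero s (n - s) (r := s + n - 1) (by omega) p _ ?_
  rw [Finset.forall_mem_image]
  exact h

/-- At most `s - 1` equations have a vanishing `ψ`-factor. -/
theorem card_le_of_psi (p : Fin (s + n - 1) → ℂ) {F : Finset (Fin (s + n - 1))}
    (hF : ∀ i ∈ F, s ≤ (i : ℕ)) (h : ∀ i ∈ F, eval p (psi hs i) = 0) : F.card ≤ s - 1 := by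
  rw [← card_image_sub hF]
  refine card_le_of_eval_hilbertForm_eq_zero n (s - 1) (r := s + n - 1) (by omega) p _ ?_
  rw [Finset.forall_mem_image]
  exact h

include hs hsn in
theorem card_upper_sdiff {E : Finset (Fin (s + n - 1))} (hE : ∀ i ∈ E, s ≤ (i : ℕ)) :
    (upper n s \ E).card = n - 1 - E.card := by
  rw [Finset.card_sdiff_of_subset fun i hi => mem_upper.mpr (hE i hi), card_upper hs hsn]

include hs hsn in
theorem det_factorMatrix_ne_zero (hdm : ∀ i, d i ≤ dm) {E : Finset (Fin (s + n - 1))}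
    {c : Fin (s + n - 1) → ℕ} (hEc : ⟨E, c⟩ ∈ choices n s d) :
    (factorMatrix dm E c).det ≠ 0 := by
  obtain ⟨hE, hcard, hc, -⟩ := (mem_choices d).mp hEc
  intro h0
  obtain ⟨v, hv, hMv⟩ := Matrix.exists_mulVec_eq_zero_iff.mpr h0
  apply hv
  have row : ∀ i : Fin (s + n - 1), (if (i : ℕ) < s then Pi.single i 1
      else if i ∈ E then hilbertCoeff s (n - s) (((i : ℕ) - s) * dm + c i)
      else hilbertCoeff n (s - 1) ((i : ℕ) - s) : Fin (s + n - 1) → ℂ) ⬝ᵥ v = 0 :=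
    fun i => congrFun hMv i
  funext j
  rcases lt_or_ge (j : ℕ) s with hj | hj
  · simpa [hj] using row j
  rcases lt_or_ge (j : ℕ) n with hjn | hjn
  · refine eq_zero_of_hilbertCoeff_dotProduct_eq_zero s (n - s) (by omega) v
      (E.image fun i : Fin (s + n - 1) => ((i : ℕ) - s) * dm + c i) ?_ ?_ j hj (by omega)
    · rw [card_image_mul_add hE fun i hi => (hc i (Or.inr hi)).trans_le (hdm i), hcard]
    · rw [Finset.forall_mem_image]
      intro i hi
      have h1 := row i
      rwa [if_neg (hE i hi).not_gt, if_pos hi] at h1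
  · have hF : ∀ i ∈ upper n s \ E, s ≤ (i : ℕ) := fun i hi =>
      mem_upper.mp (Finset.mem_sdiff.mp hi).1
    refine eq_zero_of_hilbertCoeff_dotProduct_eq_zero n (s - 1) (by omega) v
      ((upper n s \ E).image fun i : Fin (s + n - 1) => (i : ℕ) - s) ?_ ?_ j hjn (by omega)
    · rw [card_image_sub hF, card_upper_sdiff hs hsn hE, hcard]
      omega
    · rw [Finset.forall_mem_image]
      intro i hi
      have h1 := row i
      rwa [if_neg (hF i hi).not_gt, if_neg (Finset.mem_sdiff.mp hi).2] at h1

theorem exists_zero_factor (hdm : ∀ i, d i ≤ dm) {E : Finset (Fin (s + n - 1))}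
    {c : Fin (s + n - 1) → ℕ} (hEc : ⟨E, c⟩ ∈ choices n s d) :
    ∃ p, ∀ i, eval p (factor hs hsn dm E c i) = 0 := by
  have hu : IsUnit (factorMatrix dm E c).det :=
    isUnit_iff_ne_zero.mpr (det_factorMatrix_ne_zero hs hsn hdm hEc)
  refine ⟨(factorMatrix dm E c)⁻¹.mulVec fun i => -eval 0 (factor hs hsn dm E c i), fun i => ?_⟩
  rw [eval_factor, Matrix.mulVec_mulVec, Matrix.mul_nonsing_inv _ hu, Matrix.one_mulVec]
  ring

theorem zero_factor_unique (hdm : ∀ i, d i ≤ dm) {E : Finset (Fin (s + n - 1))}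
    {c : Fin (s + n - 1) → ℕ} (hEc : ⟨E, c⟩ ∈ choices n s d) {p q : Fin (s + n - 1) → ℂ}
    (hp : ∀ i, eval p (factor hs hsn dm E c i) = 0)
    (hq : ∀ i, eval q (factor hs hsn dm E c i) = 0) : p = q := by
  have hu : IsUnit (factorMatrix dm E c) := (Matrix.isUnit_iff_isUnit_det _).mpr
    (isUnit_iff_ne_zero.mpr (det_factorMatrix_ne_zero hs hsn hdm hEc))
  refine Matrix.mulVec_injective_of_isUnit hu (funext fun i => ?_)
  have h1 := hp i
  have h2 := hq i
  rw [eval_factor] at h1 h2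
  linear_combination h1 - h2

section ZeroFactor

variable (hdm : ∀ i, d i ≤ dm) {E : Finset (Fin (s + n - 1))}
    {c : Fin (s + n - 1) → ℕ} (hEc : ⟨E, c⟩ ∈ choices n s d) {p : Fin (s + n - 1) → ℂ}
    (hp : ∀ i, eval p (factor hs hsn dm E c i) = 0)

include hp in
theorem eq_of_zero_factor {i : Fin (s + n - 1)} (hi : (i : ℕ) < s) : p i = c i + 1 := by
  simpa [factor, hi, sub_eq_zero] using hp i

include hEc hp in
theorem eval_phi_eq_zero_of_mem {i : Fin (s + n - 1)} (hi : i ∈ E) :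
    eval p (phi hs hsn dm i (c i)) = 0 := by
  have h1 := hp i
  rwa [factor, if_neg (((mem_choices d).mp hEc).1 i hi).not_gt, if_pos hi] at h1

include hp in
theorem eval_psi_eq_zero_of_notMem {i : Fin (s + n - 1)} (hi : s ≤ (i : ℕ)) (hiE : i ∉ E) :
    eval p (psi hs i) = 0 := by
  have h1 := hp i
  rwa [factor, if_neg hi.not_gt, if_neg hiE] at h1

include hdm hEc hp in
/-- At a common zero of the chosen factors, no other `φ`-factor vanishes. -/
theorem mem_and_eq_of_eval_phi_eq_zero {i : Fin (s + n - 1)} (hi : s ≤ (i : ℕ)) {j : ℕ}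
    (hj : j < d i) (h : eval p (phi hs hsn dm i j) = 0) : i ∈ E ∧ j = c i := by
  obtain ⟨hE, hcard, hc, -⟩ := (mem_choices d).mp hEc
  have hcd : ∀ i ∈ E, c i < dm := fun i hi => (hc i (Or.inr hi)).trans_le (hdm i)
  by_contra hne
  have hnot : ((i : ℕ) - s) * dm + j ∉ E.image fun i : Fin (s + n - 1) => ((i : ℕ) - s) * dm + c i := by
    intro hmem
    obtain ⟨i', hi', heq⟩ := Finset.mem_image.mp hmem
    obtain ⟨rfl, rfl⟩ := mul_add_inj (hE i' hi') hi (hcd i' hi') (hj.trans_le (hdm i)) heq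
    exact hne ⟨hi', rfl⟩
  have h1 := card_le_of_eval_hilbertForm_eq_zero s (n - s) (r := s + n - 1) (by omega) p
    (insert (((i : ℕ) - s) * dm + j) (E.image fun i : Fin (s + n - 1) => ((i : ℕ) - s) * dm + c i)) ?_
  · rw [Finset.card_insert_of_notMem hnot, card_image_mul_add hE hcd, hcard] at h1
    omega
  · rw [Finset.forall_mem_insert, Finset.forall_mem_image]
    exact ⟨h, fun i hi => eval_phi_eq_zero_of_mem hs hsn hEc hp hi⟩

include hEc hp in
/-- At a common zero of the chosen factors, no other `ψ`-factor vanishes. -/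
theorem eval_psi_ne_zero_of_mem {i : Fin (s + n - 1)} (hi : i ∈ E) :
    eval p (psi hs i) ≠ 0 := by
  obtain ⟨hE, hcard, -, -⟩ := (mem_choices d).mp hEc
  intro h
  have hnot : i ∉ upper n s \ E := fun h => (Finset.mem_sdiff.mp h).2 hi
  have h1 := card_le_of_psi hs p (F := insert i (upper n s \ E)) ?_ ?_
  · rw [Finset.card_insert_of_notMem hnot, card_upper_sdiff hs hsn hE, hcard] at h1
    omega
  · rw [Finset.forall_mem_insert]
    exact ⟨hE i hi, fun i hi => mem_upper.mp (Finset.mem_sdiff.mp hi).1⟩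
  · rw [Finset.forall_mem_insert]
    refine ⟨h, fun i hi => ?_⟩
    obtain ⟨h1, h2⟩ := Finset.mem_sdiff.mp hi
    exact eval_psi_eq_zero_of_notMem hs hsn hp (mem_upper.mp h1) h2

include hdm hEc hp in
/-- A chosen factor divides its equation, with a cofactor not vanishing at the common zero. -/
theorem exists_cofactor (i : Fin (s + n - 1)) :
    ∃ h, typeOneSystem n s hs hsn d dm i = factor hs hsn dm E c i * h ∧ eval p h ≠ 0 := by
  obtain ⟨hE, -, hc, -⟩ := (mem_choices d).mp hEc
  rcases lt_or_ge (i : ℕ) s with hi | hi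
  · refine ⟨∏ j ∈ (Finset.range (d i)).erase (c i), (X i - C ((j : ℂ) + 1)), ?_, ?_⟩
    · rw [typeOneSystem_of_lt hs hsn d dm hi, factor, if_pos hi,
        Finset.mul_prod_erase _ (fun j : ℕ => X i - C ((j : ℂ) + 1))
          (Finset.mem_range.mpr (hc i (Or.inl hi)))]
    · rw [map_prod, Finset.prod_ne_zero_iff]
      intro j hj h0
      simp only [map_sub, eval_X, eval_C, eq_of_zero_factor hs hsn hp hi, add_sub_add_right_eq_sub,
        sub_eq_zero, Nat.cast_inj] at h0
      exact (Finset.mem_erase.mp hj).1 h0.symm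
  by_cases hiE : i ∈ E
  · refine ⟨(∏ j ∈ (Finset.range (d i)).erase (c i), phi hs hsn dm i j) * psi hs i, ?_, ?_⟩
    · rw [typeOneSystem_of_le hs hsn d dm hi, factor, if_neg hi.not_gt, if_pos hiE, ← mul_assoc,
        Finset.mul_prod_erase _ _ (Finset.mem_range.mpr (hc i (Or.inr hiE)))]
    · rw [map_mul, map_prod]
      refine mul_ne_zero (Finset.prod_ne_zero_iff.mpr fun j hj h0 => ?_)
        (eval_psi_ne_zero_of_mem hs hsn hEc hp hiE)
      obtain ⟨hj1, hj2⟩ := Finset.mem_erase.mp hj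
      exact hj1 (mem_and_eq_of_eval_phi_eq_zero hs hsn hdm hEc hp hi (Finset.mem_range.mp hj2) h0).2
  · refine ⟨∏ j ∈ Finset.range (d i), phi hs hsn dm i j, ?_, ?_⟩
    · rw [typeOneSystem_of_le hs hsn d dm hi, factor, if_neg hi.not_gt, if_neg hiE, mul_comm]
    · rw [map_prod]
      refine Finset.prod_ne_zero_iff.mpr fun j hj h0 => ?_
      exact hiE
        (mem_and_eq_of_eval_phi_eq_zero hs hsn hdm hEc hp hi (Finset.mem_range.mp hj) h0).1

include hdm hEc hp in
theorem eval_typeOneSystem_of_zero_factor (i : Fin (s + n - 1)) :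
    eval p (typeOneSystem n s hs hsn d dm i) = 0 := by
  obtain ⟨h, hh, -⟩ := exists_cofactor hs hsn hdm hEc hp i
  rw [hh, map_mul, hp i, zero_mul]

include hdm hEc hp in
theorem det_jacobian_ne_zero :
    (Matrix.of fun i j : Fin (s + n - 1) =>
      eval p (pderiv j (typeOneSystem n s hs hsn d dm i))).det ≠ 0 := by
  choose h hh hne using exists_cofactor hs hsn hdm hEc hp
  have : (Matrix.of fun i j : Fin (s + n - 1) =>
      eval p (pderiv j (typeOneSystem n s hs hsn d dm i))) =
      Matrix.of fun i j => eval p (h i) * factorMatrix dm E c i j := by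
    ext i j
    simp [hh i, Derivation.leibniz, pderiv_factor, hp i]
  rw [this, Matrix.det_mul_column]
  exact mul_ne_zero (Finset.prod_ne_zero_iff.mpr fun i _ => hne i)
    (det_factorMatrix_ne_zero hs hsn hdm hEc)

include hdm hEc hp in
/-- The `x`-components of a common zero of the chosen factors determine the choice. -/
theorem choice_eq_of_eq_on_x {E' : Finset (Fin (s + n - 1))} {c' : Fin (s + n - 1) → ℕ}
    (hEc' : ⟨E', c'⟩ ∈ choices n s d) {q : Fin (s + n - 1) → ℂ}
    (hq : ∀ i, eval q (factor hs hsn dm E' c' i) = 0)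
    (hpq : ∀ j : Fin (s + n - 1), (j : ℕ) < n → p j = q j) : E = E' ∧ c = c' := by
  obtain ⟨hE, hcard, hc, hc0⟩ := (mem_choices d).mp hEc
  obtain ⟨hE', hcard', hcc', hc0'⟩ := (mem_choices d).mp hEc'
  have hphi : ∀ i j, eval p (phi hs hsn dm i j) = eval q (phi hs hsn dm i j) := by
    intro i j
    simp only [phi, eval_hilbertForm]
    rw [hilbertCoeff_dotProduct _ _ _ (by omega), hilbertCoeff_dotProduct _ _ _ (by omega)]
    congr 1
    refine Finset.sum_congr rfl fun b _ => ?_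
    rw [hpq _ (by simp only; omega)]
  have key : ∀ i ∈ E', i ∈ E ∧ c' i = c i := fun i hi =>
    mem_and_eq_of_eval_phi_eq_zero hs hsn hdm hEc hp (hE' i hi) (hcc' i (Or.inr hi))
      ((hphi i _).trans (eval_phi_eq_zero_of_mem hs hsn hEc' hq hi))
  have hEE : E' = E := Finset.eq_of_subset_of_card_le (fun i hi => (key i hi).1) (by omega)
  subst hEE
  refine ⟨rfl, funext fun i => ?_⟩
  rcases lt_or_ge (i : ℕ) s with hi | hi
  · have h1 := hpq i (by omega)
    rw [eq_of_zero_factor hs hsn hp hi, eq_of_zero_factor hs hsn hq hi] at h1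
    exact_mod_cast add_right_cancel h1
  by_cases hiE : i ∈ E'
  · exact (key i hiE).2.symm
  · rw [hc0 i hi hiE, hc0' i hi hiE]

end ZeroFactor

theorem exists_choice_of_eval_eq_zero (hdm : ∀ i, d i ≤ dm) {p : Fin (s + n - 1) → ℂ}
    (hp : ∀ i, eval p (typeOneSystem n s hs hsn d dm i) = 0) :
    ∃ E c, ⟨E, c⟩ ∈ choices n s d ∧ ∀ i, eval p (factor hs hsn dm E c i) = 0 := by
  classical
  set E := (upper n s).filter fun i => ∃ j < d i, eval p (phi hs hsn dm i j) = 0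
  have hE : ∀ i ∈ E, s ≤ (i : ℕ) := fun i hi => mem_upper.mp (Finset.mem_filter.mp hi).1
  have hpsi : ∀ i : Fin (s + n - 1), s ≤ (i : ℕ) → i ∉ E → eval p (psi hs i) = 0 := by
    intro i hi hiE
    have h := hp i
    rw [typeOneSystem_of_le hs hsn d dm hi, map_mul, map_prod] at h
    refine (mul_eq_zero.mp h).resolve_left (Finset.prod_ne_zero_iff.mpr fun j hj h0 => hiE ?_)
    exact Finset.mem_filter.mpr ⟨mem_upper.mpr hi, j, Finset.mem_range.mp hj, h0⟩
  have hex : ∀ i : Fin (s + n - 1), ∃ j : ℕ,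
      (((i : ℕ) < s ∨ i ∈ E) → j < d i) ∧ (s ≤ (i : ℕ) → i ∉ E → j = 0) ∧
      ((i : ℕ) < s → p i = j + 1) ∧ (i ∈ E → eval p (phi hs hsn dm i j) = 0) := by
    intro i
    rcases lt_or_ge (i : ℕ) s with hi | hi
    · have h := hp i
      rw [typeOneSystem_of_lt hs hsn d dm hi, map_prod, Finset.prod_eq_zero_iff] at h
      obtain ⟨j, hj, hj0⟩ := h
      refine ⟨j, fun _ => Finset.mem_range.mp hj, fun h => absurd h hi.not_ge, fun _ => ?_,
        fun h => absurd (hE i h) hi.not_ge⟩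
      simpa [sub_eq_zero] using hj0
    by_cases hiE : i ∈ E
    · obtain ⟨-, j, hj, hj0⟩ := Finset.mem_filter.mp hiE
      exact ⟨j, fun _ => hj, fun _ h => absurd hiE h, fun h => absurd h hi.not_gt, fun _ => hj0⟩
    · exact ⟨0, fun h => absurd h (by simp [hiE, hi]), fun _ _ => rfl,
        fun h => absurd h hi.not_gt, fun h => absurd h hiE⟩
  choose c hc hc0 hx hphi using hex
  refine ⟨E, c, (mem_choices d).mpr ⟨hE, ?_, hc, hc0⟩, fun i => ?_⟩
  · have h1 := card_le_of_phi hs hsn p hE (fun i hi => (hc i (Or.inr hi)).trans_le (hdm i)) hphi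
    have h2 := card_le_of_psi hs p (F := upper n s \ E)
      (fun i hi => mem_upper.mp (Finset.mem_sdiff.mp hi).1)
      (fun i hi => hpsi i (mem_upper.mp (Finset.mem_sdiff.mp hi).1) (Finset.mem_sdiff.mp hi).2)
    rw [card_upper_sdiff hs hsn hE] at h2
    omega
  · rw [factor]
    split_ifs with h1 h2
    · simp [hx i h1]
    · exact hphi i h2
    · exact hpsi i (not_lt.mp h1) h2

end TypeOne

open TypeOne in
theorem statement3 (n s : ℕ) (hn : 3 ≤ n) (hs : 2 ≤ s) (hsn : s ≤ n - 1)
    (d : Fin (s + n - 1) → ℕ) (hd : ∀ i, 0 < d i)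
    (dm : ℕ) (hdm0 : 0 < dm) (hdm : ∀ i, d i ≤ dm)
    (sols : Set (Fin (s + n - 1) → ℂ))
    (hsols : sols = {p | ∀ i, eval p (typeOneSystem n s hs hsn d dm i) = 0}) :
    sols.Finite ∧
    sols.ncard =
      (∏ i ∈ Finset.univ.filter (fun i : Fin (s + n - 1) => (i : ℕ) < s), d i) *
        ∑ E ∈ Finset.powersetCard (n - s)
            (Finset.univ.filter fun i : Fin (s + n - 1) => s ≤ (i : ℕ)),
          ∏ j ∈ E, d j ∧
    (∀ p ∈ sols, ∀ q ∈ sols, (∀ j : Fin (s + n - 1), (j : ℕ) < n → p j = q j) → p = q) ∧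
    ∀ p ∈ sols,
      (Matrix.of fun i j : Fin (s + n - 1) =>
        eval p (pderiv j (typeOneSystem n s hs hsn d dm i))).det ≠ 0 := by
  subst hsols
  have hex : ∀ t : Σ _ : Finset (Fin (s + n - 1)), Fin (s + n - 1) → ℕ, ∃ p,
      t ∈ choices n s d → ∀ i, eval p (factor hs hsn dm t.1 t.2 i) = 0 := by
    intro t
    by_cases ht : t ∈ choices n s d
    · obtain ⟨p, hp⟩ := exists_zero_factor hs hsn hdm ht
      exact ⟨p, fun _ => hp⟩
    · exact ⟨0, fun h => absurd h ht⟩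
  choose f hf using hex
  have himage : {p | ∀ i, eval p (typeOneSystem n s hs hsn d dm i) = 0} =
      f '' (choices n s d : Set _) := by
    ext p
    constructor
    · intro hp
      obtain ⟨E, c, hEc, hp⟩ := exists_choice_of_eval_eq_zero hs hsn hdm hp
      exact ⟨⟨E, c⟩, hEc, zero_factor_unique hs hsn hdm hEc (hf _ hEc) hp⟩
    · rintro ⟨t, ht, rfl⟩
      exact eval_typeOneSystem_of_zero_factor hs hsn hdm ht (hf t ht)
  have hinj : Set.InjOn f (choices n s d : Set _) := by
    rintro ⟨E, c⟩ ht ⟨E', c'⟩ ht' heq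
    rw [Finset.mem_coe] at ht ht'
    have h1 : ∀ i, eval (f ⟨E, c⟩) (factor hs hsn dm E c i) = 0 := hf _ ht
    have h2 : ∀ i, eval (f ⟨E', c'⟩) (factor hs hsn dm E' c' i) = 0 := hf _ ht'
    obtain ⟨rfl, rfl⟩ := choice_eq_of_eq_on_x hs hsn hdm ht h1 ht' h2 fun j _ => by rw [heq]
    rfl
  refine ⟨?_, ?_, fun p hp q hq hpq => ?_, fun p hp => ?_⟩
  · rw [himage]
    exact (choices n s d).finite_toSet.image f
  · rw [himage, hinj.ncard_image, Set.ncard_coe_finset, card_choices, upper]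
  · obtain ⟨E, c, hEc, hp⟩ := exists_choice_of_eval_eq_zero hs hsn hdm hp
    obtain ⟨E', c', hEc', hq⟩ := exists_choice_of_eval_eq_zero hs hsn hdm hq
    obtain ⟨rfl, rfl⟩ := choice_eq_of_eq_on_x hs hsn hdm hEc hp hEc' hq hpq
    exact zero_factor_unique hs hsn hdm hEc hp hq
  · obtain ⟨E, c, hEc, hp⟩ := exists_choice_of_eval_eq_zero hs hsn hdm hp
    exact det_jacobian_ne_zero hs hsn hdm hEc hp
end

section
/- Let f_1,…,f_m ∈ ℝ[x_1,…,x_n] satisfy the regularity hypothesis. Then: (i) for every S ⊆ {1,…,m} with #S > n, the polynomials f_i, i ∈ S, have no common zero in ℂⁿ; and (ii) there exists a nonzero polynomial q, with real coefficients, in the n² entries of an n×n matrix, such that every V ∈ ℚ^{n×n} with q(V) ≠ 0 is invertible and, for every nonempty S ⊆ {1,…,m}: if #S = n, the set {z ∈ ℂⁿ : f_i(Vz) = 0 for all i ∈ S} is finite; and if 1 ≤ #S ≤ n−1, the set of pairs (z, [μ]) with z ∈ ℂⁿ, μ ∈ ℂ^{#S} ∖ {0} taken up to scalar multiple, such that f_i(Vz)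 = 0 for all i = i_1,…,i_s ∈ S and ∑_{j=1}^{s} μ_j · (∂(f_{i_j}∘V)/∂x_k)(z) = 0 for all k = 2,…,n, is finite. -/
open MvPolynomial

/-- The regularity hypothesis: for every `x ∈ ℂⁿ` and every subset `S` of the indices,
if all `f_i`, `i ∈ S`, vanish at `x`, then their gradients at `x` are linearly
independent over `ℂ`. -/
def RegHyp {n m : ℕ} (f : Fin m → MvPolynomial (Fin n) ℝ) : Prop :=
  ∀ (x : Fin n → ℂ) (S : Set (Fin m)),
    (∀ i ∈ S, eval x ((f i).map (algebraMap ℝ ℂ)) = 0) →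
    LinearIndependent ℂ
      (fun i : S => fun k : Fin n => eval x (pderiv k ((f i.1).map (algebraMap ℝ ℂ))))

open scoped IntermediateField.algebraAdjoinAdjoin

theorem Derivation.map_mvPolynomial_aeval {R A M σ : Type*} [CommRing R] [CommRing A] [Algebra R A]
    [AddCommGroup M] [Module A M] [Module R M] [Fintype σ]
    (D : Derivation R A M) (x : σ → A) (p : MvPolynomial σ R) :
    D (aeval x p) = ∑ k, aeval x (pderiv k p) • D (x k) := by
  classical
  induction p using MvPolynomial.induction_on with
  | C a => simp
  | add p q hp hq => simp [hp, hq, add_smul, Finset.sum_add_distrib]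
  | mul_X p i hp =>
    simp only [map_mul, aeval_X, Derivation.leibniz, hp, pderiv_X, smul_eq_mul, map_add, add_smul,
      Finset.sum_add_distrib, Finset.smul_sum, mul_smul]
    congr 1
    rw [Finset.sum_eq_single i] <;> simp +contextual [eq_comm]

/-- The Jacobian bound on the transcendence degree: if `L` is generated as a field by a tuple `x`
satisfying equations `F` with linearly independent gradients at `x`, then an algebraically
independent family in `L` has at most `card σ - card ι` members. -/
theorem AlgebraicIndependent.card_add_card_le {K L : Type*} [Field K] [Field L] [Algebra K L]
    [Algebra.EssFiniteType K L] {σ ι τ : Type} [Fintype σ] [Fintype ι] [Fintype τ] (x : σ → L)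
    (hx : ∀ l : L, ∃ p q : MvPolynomial σ K, aeval x q ≠ 0 ∧ aeval x q * l = aeval x p)
    (F : ι → MvPolynomial σ K) (hF : ∀ i, aeval x (F i) = 0)
    (hind : LinearIndependent L fun i k => aeval x (pderiv k (F i)))
    (y : τ → L) (hy : AlgebraicIndependent K y) :
    Fintype.card τ + Fintype.card ι ≤ Fintype.card σ := by
  classical
  set W : Submodule L (σ → L) :=
    Submodule.span L (Set.range fun i k => aeval x (pderiv k (F i))) with hW
  obtain ⟨κ, a, ha, hspan, hli⟩ :=
    exists_linearIndependent' L (fun k : σ => W.mkQ (Pi.single k 1))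
  have hfull : Submodule.span L (Set.range fun k : σ => W.mkQ (Pi.single k 1)) = ⊤ := by
    have h := (Pi.basisFun L σ).span_eq
    have h2 := congrArg (Submodule.map W.mkQ) h
    rw [Submodule.map_span, Submodule.map_top, Submodule.range_mkQ, ← Set.range_comp] at h2
    have h3 : (fun k : σ => W.mkQ (Pi.single k 1)) = W.mkQ ∘ Pi.basisFun L σ := by
      funext k
      simp
    rw [h3, h2]
  have : Fintype κ := Fintype.ofInjective a ha
  have hcard : Fintype.card κ + Fintype.card ι = Fintype.card σ := by
    have h1 := finrank_span_eq_card hli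
    rw [hspan, hfull, finrank_top] at h1
    have h2 := finrank_span_eq_card hind
    rw [← h1, ← h2, Submodule.finrank_quotient_add_finrank, Module.finrank_fintype_fun_eq_card]
  let s : Set L := Set.range (x ∘ a)
  let E := IntermediateField.adjoin K s
  have hDx : ∀ k, KaehlerDifferential.D E L (x k) = 0 := by
    let D := (KaehlerDifferential.D E L).restrictScalars K
    let φ : (σ → L) →ₗ[L] Ω[L⁄E] := Fintype.linearCombination L (fun k => D (x k))
    have hφ : W ≤ LinearMap.ker φ := by
      rw [hW, Submodule.span_le]
      rintro _ ⟨i, rfl⟩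
      have := D.map_mvPolynomial_aeval x (F i)
      rw [hF, map_zero] at this
      simpa [φ, Fintype.linearCombination_apply] using this.symm
    have hz : W.liftQ φ hφ = 0 := by
      apply LinearMap.ext_on_range (hspan.trans hfull)
      intro j
      have hmem : x (a j) ∈ E := IntermediateField.subset_adjoin K s ⟨j, rfl⟩
      have := (KaehlerDifferential.D E L).map_algebraMap ⟨_, hmem⟩
      simpa [φ, D] using this
    intro k
    have := congrArg (fun g => g (W.mkQ (Pi.single k 1))) hz
    simpa [φ, D] using this
  have hD0 : ∀ l, KaehlerDifferential.D E L l = 0 := by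
    let D := (KaehlerDifferential.D E L).restrictScalars K
    have hp : ∀ p : MvPolynomial σ K, D (aeval x p) = 0 := by
      intro p
      rw [D.map_mvPolynomial_aeval]
      exact Finset.sum_eq_zero fun k _ => by
        rw [show D (x k) = 0 from hDx k, smul_zero]
    intro l
    obtain ⟨p, q, hq, h⟩ := hx l
    have h3 := congrArg D h
    rw [D.leibniz, hp, hp, smul_zero, add_zero] at h3
    exact (smul_eq_zero.mp h3).resolve_left hq
  have hunr : Algebra.FormallyUnramified E L := by
    constructor
    rw [← Submodule.subsingleton_iff L, ← subsingleton_iff_bot_eq_top,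
      ← KaehlerDifferential.span_range_derivation, eq_comm, Submodule.span_eq_bot]
    rintro _ ⟨l, rfl⟩
    exact hD0 l
  have : Algebra.EssFiniteType E L := Algebra.EssFiniteType.of_comp K E L
  have : Module.Finite E L := Algebra.FormallyUnramified.finite_of_free E L
  have : Algebra.IsAlgebraic (Algebra.adjoin K s) L :=
    (IsFractionRing.comap_isAlgebraic_iff (K := E)).mpr inferInstance
  rw [← hcard, add_le_add_iff_right]
  have h1 := hy.lift_cardinalMk_le_trdeg
  have h2 := h1.trans (Cardinal.lift_le.mpr (Algebra.IsAlgebraic.trdeg_le_cardinalMk K s))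
  have h3 := Cardinal.mk_range_le_lift (f := x ∘ a)
  simpa using h2.trans h3

theorem exists_aeval_mem_of_isPrime {K σ ι τ : Type} [Field K] [IsAlgClosed K] [Fintype σ]
    [Fintype ι] [Fintype τ] (F : ι → MvPolynomial σ K)
    (hreg : ∀ a : σ → K, (∀ i, eval a (F i) = 0) →
      LinearIndependent K fun i k => eval a (pderiv k (F i)))
    (hcard : Fintype.card σ < Fintype.card τ + Fintype.card ι)
    (y : τ → MvPolynomial σ K) (P : Ideal (MvPolynomial σ K)) [hP : P.IsPrime]
    (hFP : ∀ i, F i ∈ P) :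
    ∃ h : MvPolynomial τ K, h ≠ 0 ∧ aeval y h ∈ P := by
  let A := MvPolynomial σ K ⧸ P
  let L := FractionRing A
  let φ : MvPolynomial σ K →ₐ[K] L :=
    (IsScalarTower.toAlgHom K A L).comp (Ideal.Quotient.mkₐ K P)
  have hφ : ∀ p, φ p = 0 ↔ p ∈ P := fun p => by
    rw [← Ideal.Quotient.eq_zero_iff_mem]
    exact FaithfulSMul.algebraMap_eq_zero_iff A L
  let x : σ → L := fun k => φ (X k)
  have hx : aeval x = φ := MvPolynomial.algHom_ext fun k => by simp [x]
  have hfrac : ∀ l : L, ∃ p q : MvPolynomial σ K, aeval x q ≠ 0 ∧ aeval x q * l = aeval x p := by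
    intro l
    obtain ⟨a, b, hb, rfl⟩ := IsFractionRing.div_surjective (A := A) l
    obtain ⟨p, rfl⟩ := Ideal.Quotient.mk_surjective a
    obtain ⟨q, rfl⟩ := Ideal.Quotient.mk_surjective b
    have hq : φ q ≠ 0 := by
      rw [Ne, hφ, ← Ideal.Quotient.eq_zero_iff_mem]
      exact nonZeroDivisors.ne_zero hb
    refine ⟨p, q, by rwa [hx], ?_⟩
    rw [hx]
    exact mul_div_cancel₀ _ hq
  have hind : LinearIndependent L fun i k => aeval x (pderiv k (F i)) := by
    rw [← LinearIndependent.iff_fractionRing A L, Fintype.linearIndependent_iff]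
    intro g hg
    choose a ha using fun i => Ideal.Quotient.mk_surjective (g i)
    have hmem : ∀ k, ∑ i, a i * pderiv k (F i) ∈ P := by
      intro k
      rw [← hφ, map_sum]
      have := congrFun hg k
      rw [Finset.sum_apply] at this
      refine Eq.trans (Finset.sum_congr rfl fun i _ => ?_) this
      calc φ (a i * pderiv k (F i)) = algebraMap A L (g i) * aeval x (pderiv k (F i)) := by
            rw [map_mul, ← ha, hx]
            rfl
        _ = _ := (Algebra.smul_def _ _).symm
    intro i
    rw [← ha, Ideal.Quotient.eq_zero_iff_mem, ← IsPrime.vanishingIdeal_zeroLocus (K := K) P]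
    intro z hz
    have hz' : ∀ p ∈ P, eval z p = 0 := fun p hp => by simpa using hz p hp
    have hli := Fintype.linearIndependent_iff.mp (hreg z fun i => hz' _ (hFP i))
      (fun i => eval z (a i)) (by
        funext k
        simpa using hz' _ (hmem k)) i
    simpa using hli
  by_contra! hcon
  refine hcard.not_ge (AlgebraicIndependent.card_add_card_le x hfrac F
    (fun i => by rw [hx, hφ]; exact hFP i) hind (fun t => φ (y t)) ?_)
  rw [algebraicIndependent_iff]
  intro h hh
  by_contra h0
  refine hcon h h0 ((hφ _).mp ?_)
  rw [← hh, ← AlgHom.comp_apply, MvPolynomial.comp_aeval]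

theorem exists_eval_aeval_eq_zero {K σ ι τ : Type} [Field K] [IsAlgClosed K] [Fintype σ]
    [Fintype ι] [Fintype τ] (F : ι → MvPolynomial σ K)
    (hreg : ∀ a : σ → K, (∀ i, eval a (F i) = 0) →
      LinearIndependent K fun i k => eval a (pderiv k (F i)))
    (hcard : Fintype.card σ < Fintype.card τ + Fintype.card ι)
    (y : τ → MvPolynomial σ K) :
    ∃ h : MvPolynomial τ K, h ≠ 0 ∧
      ∀ a : σ → K, (∀ i, eval a (F i) = 0) → eval (fun t => eval a (y t)) h = 0 := by
  let I : Ideal (MvPolynomial σ K) := Ideal.span (Set.range F)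
  have hfin : I.minimalPrimes.Finite := I.finite_minimalPrimes_of_isNoetherianRing
  have hex : ∀ P : I.minimalPrimes, ∃ h : MvPolynomial τ K, h ≠ 0 ∧ aeval y h ∈ P.1 := by
    rintro ⟨P, hP⟩
    have := hP.1.1
    exact exists_aeval_mem_of_isPrime F hreg hcard y P
      fun i => hP.1.2 (Ideal.subset_span ⟨i, rfl⟩)
  choose h hne hmem using hex
  have := hfin.fintype
  refine ⟨∏ P, h P, Finset.prod_ne_zero_iff.mpr fun P _ => hne P, fun a ha => ?_⟩
  let Q : Ideal (MvPolynomial σ K) := RingHom.ker (eval a)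
  have hIQ : I ≤ Q := by
    rw [Ideal.span_le]
    rintro _ ⟨i, rfl⟩
    exact ha i
  have : Q.IsPrime := RingHom.ker_isPrime _
  obtain ⟨P, hP, hPQ⟩ := Ideal.exists_minimalPrimes_le hIQ
  have h0 : eval a (aeval y (h ⟨P, hP⟩)) = 0 := hPQ (hmem ⟨P, hP⟩)
  rw [map_prod]
  refine Finset.prod_eq_zero (Finset.mem_univ ⟨P, hP⟩) ?_
  have hC : (eval a).comp (algebraMap K (MvPolynomial σ K)) = RingHom.id K := by
    ext
    simp
  rw [← h0, MvPolynomial.map_aeval, hC]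
  rfl

/-- On a complete intersection with everywhere independent gradients, a polynomial map to a space
of at least the same dimension has finite fibres outside a hypersurface of the target. -/
theorem exists_generic_finite_fiber {K σ ι κ : Type} [Field K] [IsAlgClosed K] [Fintype σ]
    [Fintype ι] [Fintype κ] (F : ι → MvPolynomial σ K)
    (hreg : ∀ a : σ → K, (∀ i, eval a (F i) = 0) →
      LinearIndependent K fun i k => eval a (pderiv k (F i)))
    (hcard : Fintype.card σ ≤ Fintype.card κ + Fintype.card ι)
    (g : κ → MvPolynomial σ K) :
    ∃ p : MvPolynomial κ K, p ≠ 0 ∧ ∀ u : κ → K, eval u p ≠ 0 →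
      {a : σ → K | (∀ i, eval a (F i) = 0) ∧ ∀ k, eval a (g k) = u k}.Finite := by
  choose h hne hh using fun t : σ =>
    exists_eval_aeval_eq_zero (τ := Option κ) F hreg (by rw [Fintype.card_option]; omega)
      (fun o => o.elim (X t) g)
  let H : σ → Polynomial (MvPolynomial κ K) := fun t => optionEquivLeft K κ (h t)
  have hH : ∀ t, H t ≠ 0 := fun t => by simpa [H] using hne t
  refine ⟨∏ t, (H t).leadingCoeff,
    Finset.prod_ne_zero_iff.mpr fun t _ => by simpa using hH t, fun u hu => ?_⟩
  rw [map_prod, Finset.prod_ne_zero_iff] at hu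
  refine (Set.Finite.pi' fun t => ((H t).map (eval u)).rootSet_finite K).subset ?_
  rintro a ⟨ha, hg⟩ t
  have hmap : (H t).map (eval u) ≠ 0 := fun h0 => hu t (Finset.mem_univ t) <| by
    rw [Polynomial.leadingCoeff, ← Polynomial.coeff_map, h0, Polynomial.coeff_zero]
  rw [Polynomial.mem_rootSet]
  refine ⟨hmap, ?_⟩
  rw [Polynomial.coe_aeval_eq_eval, ← optionEquivLeft_elim_eval, ← hh t a ha]
  congr 1
  congr 1
  funext o
  cases o <;> simp [hg]

/-- The nonvanishing locus of a complex polynomial contains, among the real points, that of a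
nonzero real polynomial. -/
theorem exists_real_eval_ne_zero {σ : Type} (q : MvPolynomial σ ℂ) (hq : q ≠ 0) :
    ∃ r : MvPolynomial σ ℝ, r ≠ 0 ∧
      ∀ v : σ → ℝ, eval v r ≠ 0 → eval (fun i => (v i : ℂ)) q ≠ 0 := by
  classical
  obtain ⟨m, hm⟩ := MvPolynomial.ne_zero_iff.mp hq
  let c : ℂ := (starRingEnd ℂ) (coeff m q)
  refine ⟨∑ d ∈ q.support, monomial d (c * coeff d q).re, fun h0 => ?_, fun v hv h0 => hv ?_⟩
  · have h1 := congrArg (coeff m) h0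
    rw [coeff_sum] at h1
    simp only [coeff_monomial, coeff_zero, Finset.sum_ite_eq', mem_support_iff, ne_eq, hm,
      not_false_eq_true, if_true] at h1
    rw [← Complex.normSq_eq_conj_mul_self, Complex.ofReal_re] at h1
    exact hm (Complex.normSq_eq_zero.mp h1)
  · have h1 : (c * eval (fun i => (v i : ℂ)) q).re = 0 := by rw [h0, mul_zero, Complex.zero_re]
    rw [← h1, eval_eq (fun i => (v i : ℂ)), Finset.mul_sum, Complex.re_sum, map_sum]
    refine Finset.sum_congr rfl fun d _ => ?_
    rw [eval_monomial, ← mul_assoc, Finsupp.prod]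
    norm_cast
    rw [Complex.re_mul_ofReal]

theorem exists_adjugate_eval_ne_zero {K n : Type} [Field K] [Infinite K] [Fintype n]
    [DecidableEq n] [Nontrivial n] (p : MvPolynomial n K) (hp : p ≠ 0) (i : n) :
    ∃ V : Matrix n n K, eval (V.adjugate i) p ≠ 0 := by
  obtain ⟨j, hj⟩ := exists_ne i
  obtain ⟨u, hu⟩ : ∃ u : n → K, eval u (p * X i) ≠ 0 := by
    by_contra! h
    exact mul_ne_zero hp (X_ne_zero i) (MvPolynomial.funext fun u => by rw [h, map_zero])
  rw [map_mul, eval_X, mul_ne_zero_iff] at hu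
  let d : n → K := Function.update 1 j (u i)⁻¹
  let W : Matrix n n K := (Matrix.diagonal d).updateRow i u
  have hd : ∏ k ∈ Finset.univ.erase i, d k = (u i)⁻¹ := by
    rw [Finset.prod_eq_single j]
    · simp [d]
    · intro k _ hk
      simp [d, hk]
    · simp [hj]
  have hW : W.det = 1 := by
    have h1 : W.det = u i * ∏ k ∈ Finset.univ.erase i, d k := by
      rw [← Matrix.cramer_transpose_apply, Matrix.cramer_eq_adjugate_mulVec,
        Matrix.diagonal_transpose, Matrix.adjugate_diagonal, Matrix.mulVec_diagonal, mul_comm]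
    rw [h1, hd, mul_inv_cancel₀ hu.2]
  refine ⟨W.adjugate, ?_⟩
  rw [Matrix.adjugate_adjugate', hW, one_pow, one_smul]
  simpa [W] using hu.1

theorem exists_polynomial_adjugate_row {K n : Type} [Field K] [Infinite K] [Fintype n]
    [DecidableEq n] [Nontrivial n] (p : MvPolynomial n K) (hp : p ≠ 0) (i : n) :
    ∃ q : MvPolynomial (n × n) K, q ≠ 0 ∧
      ∀ V : Matrix n n K, eval (fun ij => V ij.1 ij.2) q = eval (V.adjugate i) p := by
  let q : MvPolynomial (n × n) K := aeval ((Matrix.mvPolynomialX n n K).adjugate i) p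
  have hq : ∀ V : Matrix n n K, eval (fun ij => V ij.1 ij.2) q = eval (V.adjugate i) p := by
    intro V
    have hC : (eval fun ij : n × n => V ij.1 ij.2).comp
        (algebraMap K (MvPolynomial (n × n) K)) = RingHom.id K := by
      ext
      simp
    have hrow : ∀ k, eval (fun ij : n × n => V ij.1 ij.2)
        ((Matrix.mvPolynomialX n n K).adjugate i k) = V.adjugate i k := by
      intro k
      have h := RingHom.map_adjugate (eval fun ij : n × n => V ij.1 ij.2)
        (Matrix.mvPolynomialX n n K)
      rw [Matrix.mvPolynomialX_mapMatrix_eval] at h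
      rw [← h]
      rfl
    rw [MvPolynomial.map_aeval, hC]
    simp only [hrow]
    rfl
  refine ⟨q, fun h0 => ?_, hq⟩
  obtain ⟨V, hV⟩ := exists_adjugate_eval_ne_zero p hp i
  rw [← hq, h0, map_zero] at hV
  exact hV rfl

theorem linearIndependent_pderiv_rename_inl {K n ι : Type} [Field K]
    (g : ι → MvPolynomial n K)
    (hreg : ∀ a : n → K, (∀ i, eval a (g i) = 0) →
      LinearIndependent K fun i k => eval a (pderiv k (g i)))
    (a : n ⊕ ι → K) (ha : ∀ i, eval a (rename Sum.inl (g i)) = 0) :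
    LinearIndependent K fun i k => eval a (pderiv k (rename (Sum.inl : n → n ⊕ ι) (g i))) := by
  refine LinearIndependent.of_comp (LinearMap.funLeft K K (Sum.inl : n → n ⊕ ι)) ?_
  convert hreg (a ∘ Sum.inl) fun i => by rw [← eval_rename]; exact ha i using 1
  funext i k
  simp [LinearMap.funLeft_apply, pderiv_rename Sum.inl_injective, eval_rename]

section LinearChange

variable {K n : Type} [Field K] [Fintype n]

/-- The polynomial `z ↦ g (V z)`. -/
noncomputable def compMatrix (V : Matrix n n K) (g : MvPolynomial n K) : MvPolynomial n K :=
  aeval (fun j => ∑ k, C (V j k) * X k) g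

theorem eval_aeval_linear (V : Matrix n n K) (g : MvPolynomial n K) (z : n → K) :
    eval z (aeval (fun j => ∑ k, C (V j k) * X k : n → MvPolynomial n K) g) =
      eval (V.mulVec z) g := by
  have hC : (eval z).comp (algebraMap K (MvPolynomial n K)) = RingHom.id K := by
    ext
    simp
  rw [MvPolynomial.map_aeval, hC]
  simp only [map_sum, map_mul, eval_C, eval_X]
  rfl

theorem eval_compMatrix (V : Matrix n n K) (g : MvPolynomial n K) (z : n → K) :
    eval z (compMatrix V g) = eval (V.mulVec z) g :=
  eval_aeval_linear V g z

theorem eval_pderiv_compMatrix (V : Matrix n n K) (g : MvPolynomial n K) (z : n → K) (k : n) :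
    eval z (pderiv k (compMatrix V g)) =
      Matrix.vecMul (fun j => eval (V.mulVec z) (pderiv j g)) V k := by
  classical
  rw [compMatrix, Derivation.map_mvPolynomial_aeval, map_sum]
  refine Finset.sum_congr rfl fun j _ => ?_
  rw [smul_eq_mul, map_mul, eval_aeval_linear]
  congr 1
  simp [pderiv_X, Pi.single_apply]

theorem exists_generic_finite_multipliers [IsAlgClosed K] {ι : Type} [Fintype ι]
    (g : ι → MvPolynomial n K)
    (hreg : ∀ a : n → K, (∀ i, eval a (g i) = 0) →
      LinearIndependent K fun i k => eval a (pderiv k (g i))) :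
    ∃ p : MvPolynomial n K, p ≠ 0 ∧ ∀ u : n → K, eval u p ≠ 0 →
      {a : (n → K) × (ι → K) | (∀ i, eval a.1 (g i) = 0) ∧
        ∀ k, ∑ j, a.2 j * eval a.1 (pderiv k (g j)) = u k}.Finite := by
  obtain ⟨p, hp, h⟩ := exists_generic_finite_fiber
    (fun i => rename (Sum.inl : n → n ⊕ ι) (g i)) (linearIndependent_pderiv_rename_inl g hreg)
    (by simp) (fun k : n => ∑ j, X (Sum.inr j) * rename Sum.inl (pderiv k (g j)))
  refine ⟨p, hp, fun u hu => ?_⟩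
  refine Set.Finite.of_injOn (f := fun a => Sum.elim a.1 a.2) ?_ ?_ (h u hu)
  · rintro ⟨z, μ⟩ ⟨hz, hμ⟩
    simpa [eval_rename] using And.intro hz hμ
  · rintro ⟨z, μ⟩ _ ⟨z', μ'⟩ _ heq
    simpa [Sum.elim_eq_iff] using heq

/-- The multiplier equations for `g ∘ V` away from the coordinate `i₀` say that, up to scaling, the
combination of the gradients of `g` is the row `i₀` of the adjugate of `V`. -/
theorem finite_critical_pairs [DecidableEq n] {ι : Type} [Fintype ι]
    (g : ι → MvPolynomial n K)
    (hreg : ∀ a : n → K, (∀ i, eval a (g i) = 0) →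
      LinearIndependent K fun i k => eval a (pderiv k (g i)))
    (V : Matrix n n K) (hV : V.det ≠ 0) (i₀ : n)
    (hfin : {a : (n → K) × (ι → K) | (∀ i, eval a.1 (g i) = 0) ∧
        ∀ k, ∑ j, a.2 j * eval a.1 (pderiv k (g j)) = V.adjugate i₀ k}.Finite) :
    {p : (n → K) × Projectivization K (ι → K) | (∀ i, eval p.1 (compMatrix V (g i)) = 0) ∧
      ∀ k, k ≠ i₀ → ∑ j, p.2.rep j * eval p.1 (pderiv k (compMatrix V (g j))) = 0}.Finite := by
  let c : (n → K) × Projectivization K (ι → K) → K := fun p =>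
    ∑ j, p.2.rep j * eval p.1 (pderiv i₀ (compMatrix V (g j)))
  have key : ∀ p : (n → K) × Projectivization K (ι → K),
      (∀ i, eval p.1 (compMatrix V (g i)) = 0) →
      (∀ k, k ≠ i₀ → ∑ j, p.2.rep j * eval p.1 (pderiv k (compMatrix V (g j))) = 0) →
      c p ≠ 0 ∧ ∀ k, V.det * ∑ j, p.2.rep j * eval (V.mulVec p.1) (pderiv k (g j)) =
        c p * V.adjugate i₀ k := by
    rintro ⟨z, μ⟩ hz hμ
    let G : n → K := ∑ j, μ.rep j • fun k => eval (V.mulVec z) (pderiv k (g j))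
    have hG : ∀ k, G k = ∑ j, μ.rep j * eval (V.mulVec z) (pderiv k (g j)) := fun k => by
      simp [G]
    have hGV : ∀ k, Matrix.vecMul G V k =
        ∑ j, μ.rep j * eval z (pderiv k (compMatrix V (g j))) := fun k => by
      simp [G, Matrix.sum_vecMul, Matrix.smul_vecMul, eval_pderiv_compMatrix]
    have hsingle : Matrix.vecMul G V = Pi.single i₀ (c (z, μ)) := by
      funext k
      rw [hGV]
      by_cases hk : k = i₀
      · subst hk
        rw [Pi.single_eq_same]
      · rw [Pi.single_eq_of_ne hk]
        exact hμ k hk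
    have hdet : ∀ k, V.det * G k = c (z, μ) * V.adjugate i₀ k := by
      intro k
      have h := congrFun (congrArg (fun v => Matrix.vecMul v V.adjugate) hsingle) k
      simpa [Matrix.vecMul_vecMul, Matrix.mul_adjugate, Matrix.vecMul_smul] using h
    refine ⟨fun hc => μ.rep_nonzero ?_, fun k => by rw [← hG]; exact hdet k⟩
    have hG0 : G = 0 := by
      funext k
      have h := hdet k
      rw [hc, zero_mul] at h
      exact (mul_eq_zero.mp h).resolve_left hV
    funext j
    exact Fintype.linearIndependent_iff.mp
      (hreg (V.mulVec z) fun i => by rw [← eval_compMatrix]; exact hz i) _ hG0 j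
  refine Set.Finite.of_injOn (f := fun p => (V.mulVec p.1, (V.det / c p) • p.2.rep)) ?_ ?_ hfin
  · rintro p ⟨hz, hμ⟩
    obtain ⟨hc, h⟩ := key p hz hμ
    refine ⟨fun i => by rw [← eval_compMatrix]; exact hz i, fun k => ?_⟩
    simp only [Pi.smul_apply, smul_eq_mul, mul_assoc]
    rw [← Finset.mul_sum, div_mul_eq_mul_div, h k, mul_div_cancel_left₀ _ hc]
  · rintro p ⟨hz, hμ⟩ p' ⟨hz', hμ'⟩ heq
    have hc := (key p hz hμ).1
    have hc' := (key p' hz' hμ').1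
    rw [Prod.mk.injEq] at heq
    refine Prod.ext ?_ ?_
    · exact Matrix.mulVec_injective_of_isUnit
        ((Matrix.isUnit_iff_isUnit_det V).mpr hV.isUnit) heq.1
    · rw [← p.2.mk_rep, ← p'.2.mk_rep, Projectivization.mk_eq_mk_iff']
      refine ⟨(V.det / c p)⁻¹ * (V.det / c p'), ?_⟩
      rw [mul_smul, ← heq.2, inv_smul_smul₀ (div_ne_zero hV hc)]

theorem finite_zeros_compMatrix [IsAlgClosed K] [DecidableEq n] {ι : Type} [Fintype ι]
    (g : ι → MvPolynomial n K)
    (hreg : ∀ a : n → K, (∀ i, eval a (g i) = 0) →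
      LinearIndependent K fun i k => eval a (pderiv k (g i)))
    (hcard : Fintype.card n = Fintype.card ι) (V : Matrix n n K) (hV : V.det ≠ 0) :
    {z : n → K | ∀ i, eval z (compMatrix V (g i)) = 0}.Finite := by
  obtain ⟨p, hp, h⟩ := exists_generic_finite_fiber (κ := Empty) g hreg (by simp [hcard])
    Empty.elim
  obtain ⟨u, hu⟩ : ∃ u : Empty → K, eval u p ≠ 0 := by
    by_contra! h
    exact hp (MvPolynomial.funext fun u => by rw [h, map_zero])
  refine Set.Finite.of_injOn (f := V.mulVec) ?_ ?_ (h u hu)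
  · intro z hz
    exact ⟨fun i => by rw [← eval_compMatrix]; exact hz i, fun k => k.elim⟩
  · exact (Matrix.mulVec_injective_of_isUnit
      ((Matrix.isUnit_iff_isUnit_det V).mpr hV.isUnit)).injOn

end LinearChange

theorem RegHyp.linearIndependent {n m : ℕ} {f : Fin m → MvPolynomial (Fin n) ℝ} (hreg : RegHyp f)
    (S : Finset (Fin m)) (a : Fin n → ℂ)
    (ha : ∀ i : S, eval a ((f i.1).map (algebraMap ℝ ℂ)) = 0) :
    LinearIndependent ℂ fun (i : S) k => eval a (pderiv k ((f i.1).map (algebraMap ℝ ℂ))) :=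
  hreg a (S : Set (Fin m)) fun i hi => ha ⟨i, hi⟩

theorem RegHyp.exists_generic_finite_critical_pairs {n m : ℕ} (hn : 0 < n)
    {f : Fin m → MvPolynomial (Fin n) ℝ} (hreg : RegHyp f) (S : Finset (Fin m)) :
    ∃ q : MvPolynomial (Fin n × Fin n) ℂ, q ≠ 0 ∧
      ∀ V : Matrix (Fin n) (Fin n) ℂ, V.det ≠ 0 → eval (fun ij => V ij.1 ij.2) q ≠ 0 →
        S.Nonempty → S.card ≤ n - 1 →
        {p : (Fin n → ℂ) × Projectivization ℂ (S → ℂ) |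
          (∀ i : S, eval p.1 (compMatrix V ((f i.1).map (algebraMap ℝ ℂ))) = 0) ∧
          ∀ k : Fin n, k ≠ ⟨0, hn⟩ → ∑ j : S, p.2.rep j *
            eval p.1 (pderiv k (compMatrix V ((f j.1).map (algebraMap ℝ ℂ)))) = 0}.Finite := by
  by_cases hn2 : 2 ≤ n
  · have : Nontrivial (Fin n) := Fin.nontrivial_iff_two_le.mpr hn2
    obtain ⟨p, hp, h⟩ := exists_generic_finite_multipliers
      (fun i : S => (f i.1).map (algebraMap ℝ ℂ)) (hreg.linearIndependent S)
    obtain ⟨q, hq, hqp⟩ := exists_polynomial_adjugate_row p hp ⟨0, hn⟩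
    refine ⟨q, hq, fun V hV hqV _ _ => ?_⟩
    exact finite_critical_pairs _ (hreg.linearIndependent S) V hV _ (h _ (hqp V ▸ hqV))
  · refine ⟨1, one_ne_zero, fun V _ _ hS hcard => ?_⟩
    have := hS.card_pos
    omega

theorem statement4 (n m : ℕ) (hn : 0 < n) (f : Fin m → MvPolynomial (Fin n) ℝ)
    (hreg : RegHyp f) :
    (∀ S : Finset (Fin m), n < S.card →
      ¬ ∃ x : Fin n → ℂ, ∀ i ∈ S, eval x ((f i).map (algebraMap ℝ ℂ)) = 0) ∧
    ∃ q : MvPolynomial (Fin n × Fin n) ℝ, q ≠ 0 ∧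
      ∀ V : Matrix (Fin n) (Fin n) ℚ,
        eval (fun ij => ((V ij.1 ij.2 : ℚ) : ℝ)) q ≠ 0 →
          IsUnit V ∧
          ∀ S : Finset (Fin m), S.Nonempty →
            -- the polynomials fᵢ(Vx), complexified
            ∀ fV : Fin m → MvPolynomial (Fin n) ℂ,
              (fV = fun i => aeval
                  (fun j : Fin n => ∑ k : Fin n, C ((V j k : ℚ) : ℂ) * X k)
                  ((f i).map (algebraMap ℝ ℂ))) →
              (S.card = n →
                {z : Fin n → ℂ | ∀ i ∈ S, eval z (fV i) = 0}.Finite) ∧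
              (S.card ≤ n - 1 →
                {p : (Fin n → ℂ) × Projectivization ℂ (S → ℂ) |
                  (∀ i ∈ S, eval p.1 (fV i) = 0) ∧
                  ∀ k : Fin n, k ≠ ⟨0, hn⟩ →
                    ∑ j : S, p.2.rep j * eval p.1 (pderiv k (fV j.1)) = 0}.Finite) := by
  classical
  refine ⟨fun S hS ⟨x, hx⟩ => ?_, ?_⟩
  · have h := (hreg.linearIndependent S x fun i => hx i.1 i.2).fintype_card_le_finrank
    simp only [Fintype.card_coe, Module.finrank_fintype_fun_eq_card, Fintype.card_fin] at h
    omega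
  choose Q hQ hfin using hreg.exists_generic_finite_critical_pairs hn
  obtain ⟨q, hq, hqQ⟩ := exists_real_eval_ne_zero
    ((Matrix.mvPolynomialX (Fin n) (Fin n) ℂ).det * ∏ S, Q S)
    (mul_ne_zero (Matrix.det_mvPolynomialX_ne_zero _ _)
      (Finset.prod_ne_zero_iff.mpr fun S _ => hQ S))
  refine ⟨q, hq, fun V hV => ?_⟩
  let V' : Matrix (Fin n) (Fin n) ℂ := V.map (algebraMap ℚ ℂ)
  have hV' : (fun ij : Fin n × Fin n => (((V ij.1 ij.2 : ℚ) : ℝ) : ℂ)) =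
      fun ij => V' ij.1 ij.2 := by
    funext ij
    simp [V']
  have h := hqQ _ hV
  rw [hV', map_mul, map_prod, mul_ne_zero_iff, Finset.prod_ne_zero_iff,
    Matrix.eval_det_mvPolynomialX] at h
  obtain ⟨hdet, hQV⟩ := h
  refine ⟨?_, fun S hS fV hfV => ?_⟩
  · rw [Matrix.isUnit_iff_isUnit_det, isUnit_iff_ne_zero]
    intro h0
    refine hdet ?_
    have := RingHom.map_det (algebraMap ℚ ℂ) V
    rw [h0, map_zero] at this
    exact this.symm
  have hcomp : fV = fun i => compMatrix V' ((f i).map (algebraMap ℝ ℂ)) := by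
    rw [hfV]
    funext i
    simp [compMatrix, V']
  subst hcomp
  refine ⟨fun hcard => ?_, fun hcard => ?_⟩
  · simpa using finite_zeros_compMatrix _ (hreg.linearIndependent S) (by simp [hcard]) V' hdet
  · simpa using hfin S V' hdet (hQV S (Finset.mem_univ S)) hS hcard
end

section
/- Let d be an even positive integer and T the Chebyshev polynomial of the first kind of degree d. Let n ≥ 3, 2 ≤ s ≤ n−1, r = s+n−1, let τ ∈ {+1,−1}^s, and let 0 ≤ a_1 < … < a_s be integers such that a_s + n + 1 is a prime number; set A_{ik} = 1/(a_i + k) for 1 ≤ i ≤ s, 1 ≤ k ≤ n+1. Define g_i(x) = τ_i (n + A_{i,n+1} + ∑_{k=1}^{n} A_{ik} T(x_k)) for 1 ≤ i ≤ s, and g_i(x,μ) = ∑_{j=1}^{s} μ_j (∂g_j/∂x_{i−s+1})(x) for s+1 ≤ i ≤ r. Then the system g_1(x) = … = g_s(x) = 0, g_{s+1}(x, μ_1,…,μ_{s−1}, 1) = … = g_r(x, μ_1,…,μ_{s−1}, 1) = 0 has exactly D := C(n−1, s−1) · d^s · (d−1)^{n−s} solutions (x, μ) ∈ ℂⁿ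 × ℂ^{s−1} (where C(n−1,s−1) is a binomial coefficient); any two distinct solutions have distinct x-components; and at every solution, the Jacobian determinant of these r polynomials with respect to (x_1,…,x_n, μ_1,…,μ_{s−1}) is nonzero. -/
open MvPolynomial

/-- First group of polynomials of a type 2 initial system:
`g_i(x) = τ_i (n + A_{i,n+1} + ∑_{k=1}^n A_{ik} T(x_k))`, with `A_{ik} = 1/(a_i + k)`,
as polynomials in the `s+n-1` variables `x_1,…,x_n, μ_1,…,μ_{s-1}` (the variable of
index `j < n` is `x_{j+1}`, that of index `n+k` is `μ_{k+1}`; `μ_s` is substituted by `1`). -/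
noncomputable def t2first (n s : ℕ) (hs : 2 ≤ s) (d : ℕ) (τ : Fin s → ℤ) (a : Fin s → ℕ)
    (i : Fin s) : MvPolynomial (Fin (s + n - 1)) ℂ :=
  C ((τ i : ℤ) : ℂ) *
    (C (n : ℂ) + C (((a i + n + 1 : ℕ) : ℂ))⁻¹ +
      ∑ k : Fin n, C (((a i + (k : ℕ) + 1 : ℕ) : ℂ))⁻¹ *
        Polynomial.aeval (X (⟨(k : ℕ), by have := k.isLt; omega⟩ : Fin (s + n - 1)))
          (Polynomial.Chebyshev.T ℂ d))

/-- Second group of a type 2 initial system, dehomogenized with `μ_s = 1`: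
`g_{s+i+1}(x,μ) = ∑_{j=1}^{s} μ_j (∂g_j/∂x_{i+2})(x)`. -/
noncomputable def t2sec (n s : ℕ) (hs : 2 ≤ s) (hsn : s ≤ n - 1) (d : ℕ)
    (τ : Fin s → ℤ) (a : Fin s → ℕ) (i : Fin (n - 1)) :
    MvPolynomial (Fin (s + n - 1)) ℂ :=
  (∑ j : Fin (s - 1),
    X (⟨n + (j : ℕ), by have := j.isLt; omega⟩ : Fin (s + n - 1)) *
      pderiv (⟨(i : ℕ) + 1, by have := i.isLt; omega⟩ : Fin (s + n - 1))
        (t2first n s hs d τ a ⟨(j : ℕ), by have := j.isLt; omega⟩))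
    + pderiv (⟨(i : ℕ) + 1, by have := i.isLt; omega⟩ : Fin (s + n - 1))
        (t2first n s hs d τ a ⟨s - 1, by omega⟩)

/-- The full type 2 initial system (dehomogenized with `μ_s = 1`). -/
noncomputable def typeTwoSystem (n s : ℕ) (hs : 2 ≤ s) (hsn : s ≤ n - 1) (d : ℕ)
    (τ : Fin s → ℤ) (a : Fin s → ℕ) (i : Fin (s + n - 1)) :
    MvPolynomial (Fin (s + n - 1)) ℂ :=
  if h : (i : ℕ) < s then t2first n s hs d τ a ⟨(i : ℕ), h⟩
  else t2sec n s hs hsn d τ a ⟨(i : ℕ) - s, by have := i.isLt; omega⟩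

section Chebyshev

open Polynomial Polynomial.Chebyshev

lemma Polynomial.card_roots_toFinset_of_eval_derivative_ne_zero {p : ℂ[X]} (hp : p ≠ 0)
    (h : ∀ x, p.eval x = 0 → p.derivative.eval x ≠ 0) :
    p.roots.toFinset.card = p.natDegree := by
  have hnodup : p.roots.Nodup := by
    rw [Multiset.nodup_iff_count_le_one]
    intro x
    rw [count_roots]
    by_contra! hx
    obtain ⟨hx₀, hx₁⟩ := (one_lt_rootMultiplicity_iff_isRoot hp).1 hx
    exact h x hx₀ hx₁
  rw [Multiset.toFinset_card_of_nodup hnodup]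
  exact (IsAlgClosed.splits p).natDegree_eq_card_roots.symm

lemma eval_T_of_eval_derivative_eq_zero {d : ℕ} (hd : 0 < d) {x : ℂ}
    (hx : (T ℂ d).derivative.eval x = 0) : (T ℂ d).eval x = 1 ∨ (T ℂ d).eval x = -1 := by
  obtain ⟨θ, rfl⟩ := Complex.cos_surjective x
  have hd' : (d : ℂ) ≠ 0 := by exact_mod_cast hd.ne'
  have hU : (U ℂ ((d : ℤ) - 1)).eval (Complex.cos θ) = 0 := by
    simpa [T_derivative_eq_U, hd'] using hx
  have hsin := U_complex_cos θ ((d : ℤ) - 1)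
  rw [hU, zero_mul] at hsin
  rw [T_complex_cos]
  have hsq := Complex.sin_sq_add_cos_sq ((d : ℤ) * θ)
  push_cast at hsin hsq ⊢
  rw [sub_add_cancel] at hsin
  rw [← hsin] at hsq
  exact mul_self_eq_one_iff.1 (by linear_combination hsq)

lemma eval_derivative_derivative_T_ne_zero {d : ℕ} (hd : 0 < d) {x : ℂ}
    (hx : (T ℂ d).derivative.eval x = 0) : (T ℂ d).derivative.derivative.eval x ≠ 0 := by
  intro h
  have hode := congrArg (eval x)
    (one_sub_X_sq_mul_derivative_derivative_T_eq_poly_in_T (R := ℂ) (d : ℤ))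
  have hd' : (d : ℂ) ≠ 0 := by exact_mod_cast hd.ne'
  simp [hx, h, hd'] at hode
  rcases eval_T_of_eval_derivative_eq_zero hd hx with h1 | h1 <;> simp [h1] at hode

lemma card_roots_derivative_T {d : ℕ} (hd : 0 < d) :
    (T ℂ d).derivative.roots.toFinset.card = d - 1 := by
  have hdeg : (T ℂ d).derivative.natDegree = d - 1 := by
    rw [natDegree_derivative, natDegree_T, Int.natAbs_natCast]
  have hne : (T ℂ d).derivative ≠ 0 := by
    intro h
    have h0 := Polynomial.derivative_eq_zero.1 h
    rw [natDegree_T] at h0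
    omega
  rw [card_roots_toFinset_of_eval_derivative_ne_zero hne
    fun _ => eval_derivative_derivative_T_ne_zero hd, hdeg]

lemma T_sub_C_ne_zero {d : ℕ} (hd : 0 < d) (y : ℂ) : T ℂ d - Polynomial.C y ≠ 0 := by
  intro h
  have h0 := congrArg natDegree h
  rw [natDegree_sub_C, natDegree_T, natDegree_zero] at h0
  omega

lemma card_roots_T_sub_C {d : ℕ} (hd : 0 < d) {y : ℂ} (h1 : y ≠ 1) (h2 : y ≠ -1) :
    (T ℂ d - Polynomial.C y).roots.toFinset.card = d := by
  rw [card_roots_toFinset_of_eval_derivative_ne_zero (T_sub_C_ne_zero hd y), natDegree_sub_C,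
    natDegree_T, Int.natAbs_natCast]
  intro x hx hx'
  have hy : (T ℂ d).eval x = y := by simpa [sub_eq_zero] using hx
  have := eval_T_of_eval_derivative_eq_zero hd (x := x) (by simpa using hx')
  simp [hy, h1, h2] at this

end Chebyshev

section Cauchy

/-- The entry of the Cauchy matrix `1 / (a + k + 1)`. -/
noncomputable def cauchyEntry (a k : ℕ) : ℂ := ((a + k + 1 : ℕ) : ℂ)⁻¹

lemma cauchyEntry_comm (a k : ℕ) : cauchyEntry a k = cauchyEntry k a := by
  rw [cauchyEntry, cauchyEntry, Nat.add_comm a k]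

lemma eq_zero_of_sum_mul_cauchyEntry_eq_zero {ι κ : Type*} {I : Finset ι} {K : Finset κ}
    {a : ι → ℕ} {b : κ → ℕ} (ha : a.Injective) (hb : b.Injective) (hcard : I.card ≤ K.card)
    {l : ι → ℂ} (h : ∀ k ∈ K, ∑ i ∈ I, l i * cauchyEntry (a i) (b k) = 0) :
    ∀ i ∈ I, l i = 0 := by
  classical
  have hv : Set.InjOn (fun i => -(a i : ℂ)) I := fun i _ j _ hij => ha (by simpa using hij)
  set w := Lagrange.nodalWeight I (fun i => -(a i : ℂ)) with hw
  have hw0 : ∀ i ∈ I, w i ≠ 0 := fun i hi => Lagrange.nodalWeight_ne_zero hv hi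
  have hP : Lagrange.interpolate I (fun i => -(a i : ℂ)) (fun i => l i / w i) = 0 := by
    refine Polynomial.eq_zero_of_degree_lt_of_eval_index_eq_zero (s := K)
      (v := fun k => (b k : ℂ) + 1) (fun i _ j _ hij => hb (by simpa using hij))
      ((Lagrange.degree_interpolate_lt _ hv).trans_le (by exact_mod_cast hcard)) ?_
    intro k hk
    rw [Lagrange.eval_interpolate_not_at_node, ← mul_zero _, ← h k hk]
    · congr 1
      refine Finset.sum_congr rfl fun i hi => ?_
      have := hw0 i hi
      rw [← hw, cauchyEntry]
      push_cast
      rw [show (b k : ℂ) + 1 - -(a i : ℂ) = a i + b k + 1 by ring]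
      field_simp
    · intro i _ hi
      have : ((b k + 1 + a i : ℕ) : ℂ) = 0 := by push_cast; linear_combination hi
      exact absurd this (by norm_cast; omega)
  intro i hi
  have := Lagrange.eval_interpolate_at_node (fun i => l i / w i) hv hi
  rw [hP, Polynomial.eval_zero, eq_comm, div_eq_zero_iff] at this
  exact this.resolve_right (hw0 i hi)

lemma exists_sum_mul_cauchyEntry_eq {ι κ : Type*} {I : Finset ι} {K : Finset κ}
    {a : ι → ℕ} {b : κ → ℕ} (ha : a.Injective) (hb : b.Injective) (hcard : I.card = K.card)
    (r : κ → ℂ) : ∃ l : ι → ℂ, ∀ k ∈ K, ∑ i ∈ I, l i * cauchyEntry (a i) (b k) = r k := by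
  classical
  let f : (I → ℂ) →ₗ[ℂ] (K → ℂ) :=
    Matrix.mulVecLin (Matrix.of fun (k : K) (i : I) => cauchyEntry (a i) (b k))
  have hf : ∀ l k, f l k = ∑ i : I, l i * cauchyEntry (a i) (b k) := by
    intro l k
    simp [f, Matrix.mulVec, dotProduct, mul_comm]
  have hinj : Function.Injective f := by
    rw [injective_iff_map_eq_zero]
    intro l hl
    ext i
    refine eq_zero_of_sum_mul_cauchyEntry_eq_zero (I := Finset.univ) (K := Finset.univ)
      (a := fun i : I => a i) (b := fun k : K => b k) (ha.comp Subtype.val_injective)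
      (hb.comp Subtype.val_injective) (by simp [hcard]) (fun k _ => ?_) i (Finset.mem_univ i)
    rw [← hf, hl, Pi.zero_apply]
  obtain ⟨l, hl⟩ := (LinearMap.injective_iff_surjective_of_finrank_eq_finrank
    (by simp [hcard])).1 hinj (fun k => r k)
  refine ⟨fun i => if hi : i ∈ I then l ⟨i, hi⟩ else 0, fun k hk => ?_⟩
  rw [← congrFun hl ⟨k, hk⟩, hf, ← Finset.sum_coe_sort I]
  exact Finset.sum_congr rfl fun i _ => by simp

lemma exists_sum_mul_cauchyEntry_eq_prod_div {ι κ : Type*} [Fintype ι] {S : Finset κ}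
    {a : ι → ℕ} {b : κ → ℕ} (ha : a.Injective) (hcard : S.card + 1 = Fintype.card ι) :
    ∃ l : ι → ℂ, ∑ i, l i = 1 ∧ ∀ m : ℕ, ∑ i, l i * cauchyEntry (a i) m =
      (((∏ k ∈ S, ((m : ℤ) - b k) : ℤ) : ℚ) / ((∏ i, (a i + m + 1) : ℕ) : ℚ) : ℚ) := by
  classical
  set v : ι → ℂ := fun i => -(a i : ℂ)
  have hv : Set.InjOn v (Finset.univ : Finset ι) := fun i _ j _ hij =>
    ha (by simpa [v] using hij)
  set P : Polynomial ℂ := ∏ k ∈ S, (Polynomial.X - Polynomial.C ((b k : ℂ) + 1)) with hP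
  have hmonic : P.Monic := Polynomial.monic_prod_of_monic _ _ fun k _ => Polynomial.monic_X_sub_C _
  have hnat : P.natDegree = S.card := by
    rw [hP, Polynomial.natDegree_prod_of_monic _ _ fun k _ => Polynomial.monic_X_sub_C _]
    simp only [Polynomial.natDegree_X_sub_C, Finset.sum_const, smul_eq_mul, mul_one]
  have hdeg : P.degree < (Finset.univ : Finset ι).card := by
    rw [Polynomial.degree_eq_natDegree hmonic.ne_zero, hnat, Finset.card_univ, ← hcard]
    exact_mod_cast Nat.lt_succ_self _
  refine ⟨fun i => Lagrange.nodalWeight Finset.univ v i * P.eval (v i), ?_, fun m => ?_⟩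
  · have h := Lagrange.coeff_eq_sum hv hdeg
    rw [Finset.card_univ, ← hcard, Nat.add_sub_cancel, ← hnat, Polynomial.coeff_natDegree,
      hmonic.leadingCoeff] at h
    rw [h]
    refine Finset.sum_congr rfl fun i _ => ?_
    simp only [Lagrange.nodalWeight, Finset.prod_inv_distrib, div_eq_mul_inv, mul_comm]
  · have hne : ∀ i ∈ (Finset.univ : Finset ι), (m : ℂ) + 1 ≠ v i := by
      intro i _ hi
      have : ((m + 1 + a i : ℕ) : ℂ) = 0 := by push_cast; linear_combination hi
      exact absurd this (by norm_cast; omega)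
    have h := Lagrange.eval_interpolate_not_at_node (fun i => P.eval (v i)) hne
    rw [← Lagrange.eq_interpolate hv hdeg] at h
    have hnodal : (Lagrange.nodal Finset.univ v).eval ((m : ℂ) + 1)
        = ((∏ i, (a i + m + 1) : ℕ) : ℂ) := by
      rw [Lagrange.eval_nodal]
      push_cast
      exact Finset.prod_congr rfl fun i _ => by simp only [v]; ring
    have hPm : P.eval ((m : ℂ) + 1) = ((∏ k ∈ S, ((m : ℤ) - b k) : ℤ) : ℂ) := by
      rw [hP, Polynomial.eval_prod]
      push_cast
      exact Finset.prod_congr rfl fun i _ => by simp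
    have hD : ((∏ i, (a i + m + 1) : ℕ) : ℂ) ≠ 0 := by
      exact_mod_cast Finset.prod_ne_zero_iff.2 fun i _ => by omega
    rw [hnodal, hPm] at h
    rw [Rat.cast_div, Rat.cast_intCast, Rat.cast_natCast, h, mul_div_cancel_left₀ _ hD]
    refine Finset.sum_congr rfl fun i _ => ?_
    rw [cauchyEntry, show (m : ℂ) + 1 - v i = ((a i + m + 1 : ℕ) : ℂ) by
      simp only [v]; push_cast; ring]
    ring

/-- The linear system satisfied by the values `T(x_k)` at a zero of the first group. -/
def CauchyRelation (n : ℕ) {s : ℕ} (a : Fin s → ℕ) (u : Fin n → ℂ) : Prop :=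
  ∀ i, (n : ℂ) + cauchyEntry (a i) n + ∑ k : Fin n, cauchyEntry (a i) k * u k = 0

lemma CauchyRelation.card_le {n s : ℕ} {a : Fin s → ℕ} (ha : a.Injective) {j : Fin s}
    (hj : ∀ i, a i ≤ a j) (hp : (a j + n + 1).Prime) {u : Fin n → ℂ} (hu : CauchyRelation n a u)
    (hsn : s ≤ n) : (Finset.univ.filter fun k => u k = 1 ∨ u k = -1).card ≤ n - s := by
  classical
  by_contra! hcard
  set W := Finset.univ.filter fun k => u k = 1 ∨ u k = -1 with hW
  have hs : 0 < s := j.pos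
  obtain ⟨W', hW', hW'card⟩ := Finset.exists_subset_card_eq
    (show n - s + 1 ≤ W.card by omega)
  have hScard : (W'ᶜ).card + 1 = Fintype.card (Fin s) := by
    rw [Finset.card_compl, hW'card, Fintype.card_fin, Fintype.card_fin]
    omega
  obtain ⟨l, hl, hlm⟩ := exists_sum_mul_cauchyEntry_eq_prod_div (S := W'ᶜ)
    (b := fun k : Fin n => (k : ℕ)) ha hScard
  set N : ℕ → ℤ := fun m => ∏ k ∈ W'ᶜ, ((m : ℤ) - (k : ℕ))
  set D : ℕ → ℕ := fun m => ∏ i, (a i + m + 1)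
  have hε : ∀ k, ∃ ε : ℤ, k ∈ W' → u k = ε := by
    intro k
    by_cases hk : k ∈ W'
    · rcases (Finset.mem_filter.1 (hW' hk)).2 with h | h
      · exact ⟨1, fun _ => by simp [h]⟩
      · exact ⟨-1, fun _ => by simp [h]⟩
    · exact ⟨0, fun h => absurd h hk⟩
  choose ε hε using hε
  have hsum : (n : ℂ) + ((N n : ℚ) / (D n : ℚ) : ℚ) +
      ∑ k : Fin n, (((N k : ℚ) / (D k : ℚ) : ℚ) : ℂ) * u k = 0 := by
    have h : ∑ i, l i * ((n : ℂ) + cauchyEntry (a i) n +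
        ∑ k : Fin n, cauchyEntry (a i) k * u k) = 0 :=
      Finset.sum_eq_zero fun i _ => by rw [hu i, mul_zero]
    simp_rw [mul_add, Finset.sum_add_distrib, ← Finset.sum_mul, hl, one_mul, hlm,
      Finset.mul_sum, ← mul_assoc] at h
    rw [Finset.sum_comm] at h
    simp_rw [← Finset.sum_mul, hlm] at h
    exact h
  have hsumQ : (N n : ℚ) / (D n : ℚ) =
      -((n : ℤ) + ∑ k ∈ W', ((N k : ℚ) / (D k : ℚ)) * ε k) := by
    have : (∑ k : Fin n, (((N k : ℚ) / (D k : ℚ) : ℚ) : ℂ) * u k) =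
        ∑ k ∈ W', (((N k : ℚ) / (D k : ℚ) : ℚ) : ℂ) * ε k := by
      rw [← Finset.sum_subset (Finset.subset_univ W')]
      · exact Finset.sum_congr rfl fun k hk => by rw [hε k hk]
      · intro k _ hk
        have : N k = 0 := Finset.prod_eq_zero (Finset.mem_compl.2 hk) (sub_self _)
        simp [this]
    rw [this] at hsum
    have h' : ((((N n : ℚ) / (D n : ℚ) : ℚ)) : ℂ) =
      ((-((n : ℤ) + ∑ k ∈ W', ((N k : ℚ) / (D k : ℚ)) * ε k) : ℚ) : ℂ) := by
      push_cast at hsum ⊢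
      linear_combination hsum
    exact_mod_cast h'
  set p := a j + n + 1
  have : Fact p.Prime := ⟨hp⟩
  have hDk : ∀ k : Fin n, padicNorm p (D k) = 1 := by
    intro k
    rw [padicNorm.nat_eq_one_iff]
    intro hdvd
    obtain ⟨i, -, hi⟩ := (hp.prime.dvd_finsetProd_iff _).1 hdvd
    have := Nat.le_of_dvd (by omega) hi
    have := hj i
    omega
  have hDn : padicNorm p (D n) < 1 := by
    rw [padicNorm.nat_lt_one_iff]
    exact Finset.dvd_prod_of_mem (fun i => a i + n + 1) (Finset.mem_univ j)
  have hNn : padicNorm p (N n) = 1 := by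
    rw [padicNorm.int_eq_one_iff]
    intro hdvd
    obtain ⟨k, -, hk⟩ := ((Nat.prime_iff_prime_int.1 hp).dvd_finsetProd_iff _).1 hdvd
    have := Int.le_of_dvd (by omega) hk
    omega
  have hD0 : (D n : ℚ) ≠ 0 := by
    exact_mod_cast Finset.prod_ne_zero_iff.2 fun i _ => by omega
  have hle : padicNorm p ((N n : ℚ) / (D n : ℚ)) ≤ 1 := by
    rw [hsumQ, padicNorm.neg]
    refine padicNorm.nonarchimedean.trans (max_le (padicNorm.of_int _) ?_)
    refine padicNorm.sum_le' (fun k _ => ?_) zero_le_one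
    rw [padicNorm.mul, padicNorm.div, hDk, div_one]
    exact mul_le_one₀ (padicNorm.of_int _) (padicNorm.nonneg _) (padicNorm.of_int _)
  have hpos : 0 < padicNorm p (D n) :=
    lt_of_le_of_ne (padicNorm.nonneg _) (padicNorm.nonzero hD0).symm
  rw [padicNorm.div, hNn, div_le_one hpos] at hle
  exact absurd hle (not_le.2 hDn)

lemma CauchyRelation.exists_eqOn_compl {n s : ℕ} {a : Fin s → ℕ} (ha : a.Injective)
    {S : Finset (Fin n)} (hS : S.card = s) (v : Fin n → ℂ) :
    ∃ u, CauchyRelation n a u ∧ ∀ k ∉ S, u k = v k := by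
  classical
  obtain ⟨y, hy⟩ := exists_sum_mul_cauchyEntry_eq (I := S) (K := (Finset.univ : Finset (Fin s)))
    (a := fun k : Fin n => (k : ℕ)) (b := a) Fin.val_injective ha (by simp [hS])
    (fun i => -((n : ℂ) + cauchyEntry (a i) n + ∑ k ∈ Sᶜ, cauchyEntry (a i) k * v k))
  refine ⟨fun k => if k ∈ S then y k else v k, fun i => ?_, fun k hk => by simp [hk]⟩
  rw [← Finset.sum_add_sum_compl S]
  have h1 : ∑ k ∈ S, cauchyEntry (a i) k * (if k ∈ S then y k else v k) =
      ∑ k ∈ S, y k * cauchyEntry k (a i) :=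
    Finset.sum_congr rfl fun k hk => by rw [if_pos hk, cauchyEntry_comm, mul_comm]
  have h2 : ∑ k ∈ Sᶜ, cauchyEntry (a i) k * (if k ∈ S then y k else v k) =
      ∑ k ∈ Sᶜ, cauchyEntry (a i) k * v k :=
    Finset.sum_congr rfl fun k hk => by rw [if_neg (Finset.mem_compl.1 hk)]
  rw [h1, h2, hy i (Finset.mem_univ i)]
  ring

lemma eq_zero_of_sum_cauchyEntry_mul_eq_zero {n s : ℕ} {a : Fin s → ℕ} (ha : a.Injective)
    {S : Finset (Fin n)} (hS : S.card ≤ s) {y : Fin n → ℂ} (hy : ∀ k ∉ S, y k = 0)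
    (h : ∀ i, ∑ k : Fin n, cauchyEntry (a i) k * y k = 0) : y = 0 := by
  have hmem := eq_zero_of_sum_mul_cauchyEntry_eq_zero (I := S)
    (K := (Finset.univ : Finset (Fin s))) (a := fun k : Fin n => (k : ℕ)) (b := a) (l := y)
    Fin.val_injective ha (by simpa using hS) fun i _ => by
      rw [← h i, ← Finset.sum_subset (Finset.subset_univ S)]
      · exact Finset.sum_congr rfl fun k _ => by rw [cauchyEntry_comm, mul_comm]
      · intro k _ hk
        rw [hy k hk, mul_zero]
  ext k
  by_cases hk : k ∈ S
  exacts [hmem k hk, hy k hk]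

lemma CauchyRelation.eq_of_eqOn_compl {n s : ℕ} {a : Fin s → ℕ} (ha : a.Injective)
    {S : Finset (Fin n)} (hS : S.card = s) {u v : Fin n → ℂ} (hu : CauchyRelation n a u)
    (hv : CauchyRelation n a v) (h : ∀ k ∉ S, u k = v k) : u = v := by
  refine sub_eq_zero.1 (eq_zero_of_sum_cauchyEntry_mul_eq_zero ha hS.le
    (fun k hk => sub_eq_zero.2 (h k hk)) fun i => ?_)
  simp only [Pi.sub_apply, mul_sub, Finset.sum_sub_distrib]
  linear_combination hu i - hv i

end Cauchy

section Counting

open Polynomial (eval)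

lemma ncard_critical_set {n s d : ℕ} (hd : 0 < d) (hs : 0 < s) (z : Fin n)
    {Rel : (Fin n → ℂ) → Prop}
    (hcard : ∀ u, Rel u → (Finset.univ.filter fun k => u k = 1 ∨ u k = -1).card ≤ n - s)
    (hex : ∀ S : Finset (Fin n), S.card = s → ∀ v : Fin n → ℂ, ∃ u, Rel u ∧ ∀ k ∉ S, u k = v k)
    (huniq : ∀ S : Finset (Fin n), S.card = s → ∀ u v, Rel u → Rel v → (∀ k ∉ S, u k = v k) →
      u = v) :
    let T := Polynomial.Chebyshev.T ℂ d
    let X := {x : Fin n → ℂ | Rel (fun k => eval (x k) T) ∧ eval (x z) T.derivative ≠ 0 ∧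
      (Finset.univ.filter fun k => eval (x k) T.derivative ≠ 0).card = s}
    X.Finite ∧ X.ncard = Nat.choose (n - 1) (s - 1) * d ^ s * (d - 1) ^ (n - s) := by
  classical
  intro T X
  have hT' : T.derivative ≠ 0 := by
    intro h
    have h0 := Polynomial.derivative_eq_zero.1 h
    rw [Polynomial.Chebyshev.natDegree_T] at h0
    omega
  set R := T.derivative.roots.toFinset
  have hR : ∀ x, x ∈ R ↔ eval x T.derivative = 0 := fun x => by simp [R, hT']
  have hRcard : R.card = d - 1 := card_roots_derivative_T hd
  let Q : ℂ → Finset ℂ := fun y => (T - Polynomial.C y).roots.toFinset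
  have hQ : ∀ x y, x ∈ Q y ↔ eval x T = y := fun x y => by
    simp [Q, T_sub_C_ne_zero hd y, T, sub_eq_zero]
  have hone : ∀ x, eval x T.derivative = 0 → eval x T = 1 ∨ eval x T = -1 := fun x =>
    eval_T_of_eval_derivative_eq_zero hd
  have hY : ∀ (S : Finset (Fin n)) (w : Fin n → ℂ), ∃ u, S.card = s →
      Rel u ∧ ∀ k ∉ S, u k = eval (w k) T := by
    intro S w
    by_cases hS : S.card = s
    · obtain ⟨u, hu⟩ := hex S hS fun k => eval (w k) T
      exact ⟨u, fun _ => hu⟩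
    · exact ⟨0, fun h => absurd h hS⟩
  choose Y hY using hY
  -- the coordinates with index in `S` avoid the critical values
  have hYne : ∀ S w, S.card = s → (∀ k ∉ S, w k ∈ R) → ∀ k ∈ S, Y S w k ≠ 1 ∧ Y S w k ≠ -1 := by
    intro S w hS hw k hk
    obtain ⟨hrel, hYw⟩ := hY S w hS
    rw [← not_or]
    intro hbad
    have hsub : insert k Sᶜ ⊆ Finset.univ.filter fun k => Y S w k = 1 ∨ Y S w k = -1 := by
      intro m hm
      rcases Finset.mem_insert.1 hm with rfl | hm
      · simpa using hbad
      · have hm := Finset.mem_compl.1 hm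
        simpa [hYw m hm] using hone _ ((hR _).1 (hw m hm))
    have h1 := (Finset.card_le_card hsub).trans (hcard _ hrel)
    rw [Finset.card_insert_of_notMem (by simpa using hk), Finset.card_compl, hS,
      Fintype.card_fin] at h1
    omega
  let Ks := Finset.powersetCard (s - 1) (Finset.univ.erase z)
  let Ws : Finset (Fin n) → Finset (Fin n → ℂ) := fun S =>
    Fintype.piFinset fun k => if k ∈ S then {0} else R
  let Xs : Finset (Fin n) → (Fin n → ℂ) → Finset (Fin n → ℂ) := fun S w =>
    Fintype.piFinset fun k => if k ∈ S then Q (Y S w k) else {w k}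
  have hKs : ∀ K ∈ Ks, (insert z K).card = s := by
    intro K hK
    obtain ⟨hsub, hKcard⟩ := Finset.mem_powersetCard.1 hK
    rw [Finset.card_insert_of_notMem fun h => Finset.notMem_erase _ _ (hsub h), hKcard]
    omega
  have hWs : ∀ S w, w ∈ Ws S ↔ (∀ k ∈ S, w k = 0) ∧ ∀ k ∉ S, w k ∈ R := by
    intro S w
    simp only [Ws, Fintype.mem_piFinset]
    constructor
    · exact fun h => ⟨fun k hk => by simpa [hk] using h k, fun k hk => by simpa [hk] using h k⟩
    · intro h k
      by_cases hk : k ∈ S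
      · simpa [hk] using h.1 k hk
      · simpa [hk] using h.2 k hk
  have hXs : ∀ S w x, x ∈ Xs S w ↔
      (∀ k ∈ S, eval (x k) T = Y S w k) ∧ ∀ k ∉ S, x k = w k := by
    intro S w x
    simp only [Xs, Fintype.mem_piFinset]
    constructor
    · exact fun h => ⟨fun k hk => by simpa [hk, hQ] using h k,
        fun k hk => by simpa [hk] using h k⟩
    · intro h k
      by_cases hk : k ∈ S
      · simpa [hk, hQ] using h.1 k hk
      · simpa [hk] using h.2 k hk
  -- `S` is recovered from a point as the set of its noncritical coordinates
  have hsupp : ∀ S w x, S.card = s → w ∈ Ws S → x ∈ Xs S w →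
      (Finset.univ.filter fun k => eval (x k) T.derivative ≠ 0) = S := by
    intro S w x hS hw hx
    obtain ⟨hx1, hx2⟩ := (hXs S w x).1 hx
    have hw2 := ((hWs S w).1 hw).2
    ext k
    simp only [Finset.mem_filter, Finset.mem_univ, true_and]
    constructor
    · intro h
      by_contra hk
      exact h (by rw [hx2 k hk]; exact (hR _).1 (hw2 k hk))
    · intro hk h
      have h1 := hone _ h
      rw [hx1 k hk] at h1
      have h2 := hYne S w hS hw2 k hk
      tauto
  have hXeq : X = ↑(Ks.biUnion fun K => (Ws (insert z K)).biUnion fun w => Xs (insert z K) w) := by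
    ext x
    simp only [Finset.coe_biUnion, Set.mem_iUnion, Finset.mem_coe, exists_prop]
    constructor
    · rintro ⟨hrel, hz, hxs⟩
      set S := Finset.univ.filter fun k => eval (x k) T.derivative ≠ 0 with hS
      have hzS : z ∈ S := by simpa [hS] using hz
      have hin : insert z (S.erase z) = S := Finset.insert_erase hzS
      refine ⟨S.erase z, ?_, fun k => if k ∈ S then 0 else x k, ?_, ?_⟩
      · exact Finset.mem_powersetCard.2 ⟨Finset.erase_subset_erase _ (Finset.subset_univ _),
          by rw [Finset.card_erase_of_mem hzS, hxs]⟩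
      · rw [hin, hWs]
        refine ⟨fun k hk => by simp [hk], fun k hk => ?_⟩
        rw [if_neg hk, hR]
        simpa [hS] using hk
      · rw [hin, hXs]
        refine ⟨fun k hk => ?_, fun k hk => by simp [hk]⟩
        obtain ⟨hrel', hY'⟩ := hY S (fun k => if k ∈ S then 0 else x k) hxs
        have := huniq S hxs _ _ hrel hrel' fun k hk => by rw [hY' k hk, if_neg hk]
        exact congrFun this k
    · rintro ⟨K, hK, w, hw, hx⟩
      have hS := hKs K hK
      have hsup := hsupp _ w x hS hw hx
      obtain ⟨hx1, hx2⟩ := (hXs _ w x).1 hx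
      obtain ⟨hrel', hY'⟩ := hY _ w hS
      refine ⟨?_, ?_, by rw [hsup, hS]⟩
      · convert hrel' using 1
        ext k
        by_cases hk : k ∈ insert z K
        · exact hx1 k hk
        · rw [hY' k hk, hx2 k hk]
      · have : z ∈ Finset.univ.filter fun k => eval (x k) T.derivative ≠ 0 := by
          rw [hsup]; exact Finset.mem_insert_self z K
        simpa using this
  refine ⟨hXeq ▸ Finset.finite_toSet _, ?_⟩
  rw [hXeq, Set.ncard_coe_finset, Finset.card_biUnion]
  · have hinner : ∀ K ∈ Ks, ((Ws (insert z K)).biUnion fun w => Xs (insert z K) w).card =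
        (d - 1) ^ (n - s) * d ^ s := by
      intro K hK
      have hS := hKs K hK
      rw [Finset.card_biUnion]
      · have hXcard : ∀ w ∈ Ws (insert z K), (Xs (insert z K) w).card = d ^ s := by
          intro w hw
          have hw2 := ((hWs _ w).1 hw).2
          rw [Fintype.card_piFinset, ← Finset.prod_subset (Finset.subset_univ (insert z K))]
          · rw [Finset.prod_congr rfl fun k hk => ?_, Finset.prod_const, hS]
            obtain ⟨h1, h2⟩ := hYne _ w hS hw2 k hk
            rw [if_pos hk]
            exact card_roots_T_sub_C hd h1 h2
          · intro k _ hk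
            rw [if_neg hk, Finset.card_singleton]
        rw [Finset.sum_congr rfl hXcard, Finset.sum_const, smul_eq_mul]
        congr 1
        rw [Fintype.card_piFinset, ← Finset.prod_subset (Finset.subset_univ (insert z K)ᶜ)]
        · rw [Finset.prod_congr rfl fun k hk => by rw [if_neg (Finset.mem_compl.1 hk), hRcard],
            Finset.prod_const, Finset.card_compl, hS, Fintype.card_fin]
        · intro k _ hk
          rw [if_pos (by_contra fun h => hk (Finset.mem_compl.2 h)), Finset.card_singleton]
      · intro w hw w' hw' hne
        refine Finset.disjoint_left.2 fun x hx hx' => hne ?_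
        ext k
        by_cases hk : k ∈ insert z K
        · rw [((hWs _ _).1 hw).1 k hk, ((hWs _ _).1 hw').1 k hk]
        · rw [← ((hXs _ _ _).1 hx).2 k hk, ← ((hXs _ _ _).1 hx').2 k hk]
    rw [Finset.sum_congr rfl hinner, Finset.sum_const, smul_eq_mul, Finset.card_powersetCard,
      Finset.card_erase_of_mem (Finset.mem_univ z), Finset.card_univ, Fintype.card_fin]
    ring
  · intro K hK K' hK' hne
    refine Finset.disjoint_left.2 fun x hx hx' => hne ?_
    obtain ⟨w, hw, hx⟩ := Finset.mem_biUnion.1 hx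
    obtain ⟨w', hw', hx'⟩ := Finset.mem_biUnion.1 hx'
    have heq := (hsupp _ w x (hKs K hK) hw hx).symm.trans (hsupp _ w' x (hKs K' hK') hw' hx')
    have hz : ∀ K ∈ Ks, z ∉ K := fun K hK h =>
      Finset.notMem_erase _ _ ((Finset.mem_powersetCard.1 hK).1 h)
    rw [← Finset.erase_insert (hz K hK), heq, Finset.erase_insert (hz K' hK')]

end Counting

section Multipliers

open Polynomial (eval)

variable {n s d : ℕ} {a : Fin s → ℕ}

lemma card_lt_of_sum_mul_cauchyEntry_eq_zero (ha : a.Injective) {l : Fin s → ℂ} (hl : l ≠ 0)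
    {K : Finset (Fin n)} (hK : ∀ k ∈ K, ∑ j, l j * cauchyEntry (a j) k = 0) : K.card < s := by
  by_contra! h
  exact hl (funext fun i => eq_zero_of_sum_mul_cauchyEntry_eq_zero (I := Finset.univ) ha
    Fin.val_injective (by simpa using h) hK i (Finset.mem_univ i))

lemma multiplier_eq_zero (ha : a.Injective) {l : Fin s → ℂ} {j₀ : Fin s} (hl : l j₀ = 0)
    {K : Finset (Fin n)} (hKcard : s ≤ K.card + 1)
    (hK : ∀ k ∈ K, ∑ j, l j * cauchyEntry (a j) k = 0) : l = 0 := by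
  have h := eq_zero_of_sum_mul_cauchyEntry_eq_zero (I := Finset.univ.erase j₀) (K := K) (l := l)
    ha Fin.val_injective (by simp; omega) fun k hk => by
      rw [Finset.sum_erase _ (by rw [hl, zero_mul])]
      exact hK k hk
  ext j
  by_cases hj : j = j₀
  · rw [hj, hl, Pi.zero_apply]
  · exact h j (by simp [hj])

lemma exists_multiplier (ha : a.Injective) (j₀ : Fin s) {K : Finset (Fin n)}
    (hKcard : K.card + 1 = s) :
    ∃ l : Fin s → ℂ, l j₀ = 1 ∧ ∀ k ∈ K, ∑ j, l j * cauchyEntry (a j) k = 0 := by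
  classical
  obtain ⟨l, hl⟩ := exists_sum_mul_cauchyEntry_eq (I := Finset.univ.erase j₀) (K := K)
    (b := fun k : Fin n => (k : ℕ)) ha Fin.val_injective (by simp; omega)
    fun k => -cauchyEntry (a j₀) k
  refine ⟨Function.update l j₀ 1, by simp, fun k hk => ?_⟩
  rw [← Finset.add_sum_erase _ _ (Finset.mem_univ j₀), Function.update_self, one_mul,
    Finset.sum_congr rfl fun j hj => by rw [Function.update_of_ne (Finset.ne_of_mem_erase hj)],
    hl k hk, add_neg_cancel]

/-- The coordinates at which the Chebyshev polynomial is not critical. -/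
noncomputable def noncritical (d : ℕ) (x : Fin n → ℂ) : Finset (Fin n) :=
  Finset.univ.filter fun k => eval (x k) (Polynomial.Chebyshev.T ℂ d).derivative ≠ 0

lemma mem_noncritical {x : Fin n → ℂ} {k : Fin n} :
    k ∈ noncritical d x ↔ eval (x k) (Polynomial.Chebyshev.T ℂ d).derivative ≠ 0 := by
  simp [noncritical]

lemma mem_and_card_noncritical (hd : 0 < d) (hsn : s ≤ n) (ha : a.Injective) {j₀ : Fin s}
    (hj₀ : ∀ i, a i ≤ a j₀) (hp : (a j₀ + n + 1).Prime) (z : Fin n) {x : Fin n → ℂ}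
    (hx : CauchyRelation n a fun k => eval (x k) (Polynomial.Chebyshev.T ℂ d))
    {l : Fin s → ℂ} (hl : l ≠ 0)
    (hlx : ∀ k ≠ z, (∑ j, l j * cauchyEntry (a j) k) *
      eval (x k) (Polynomial.Chebyshev.T ℂ d).derivative = 0) :
    z ∈ noncritical d x ∧ (noncritical d x).card = s := by
  classical
  have hK := card_lt_of_sum_mul_cauchyEntry_eq_zero (K := (noncritical d x).erase z) ha hl
    fun k hk => (mul_eq_zero.1 (hlx k (Finset.ne_of_mem_erase hk))).resolve_right
      (mem_noncritical.1 (Finset.mem_of_mem_erase hk))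
  have hW := CauchyRelation.card_le ha hj₀ hp hx hsn
  have hC := Finset.card_le_card (show (noncritical d x)ᶜ ⊆ _ from fun k hk =>
    Finset.mem_filter.2 ⟨Finset.mem_univ k, eval_T_of_eval_derivative_eq_zero hd
      (not_not.1 fun h => Finset.mem_compl.1 hk (mem_noncritical.2 h))⟩)
  have hle := hC.trans hW
  rw [Finset.card_compl, Fintype.card_fin] at hle
  have hs := j₀.pos
  have hz : z ∈ noncritical d x := by
    by_contra hz
    rw [Finset.erase_eq_of_notMem hz] at hK
    omega
  refine ⟨hz, ?_⟩
  rw [Finset.card_erase_of_mem hz] at hK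
  omega

end Multipliers

section Evaluation

/-- The derivation of a polynomial ring in the direction of a vector. -/
noncomputable def directionalDerivation {σ : Type*} [Fintype σ] (v : σ → ℂ) :
    Derivation ℂ (MvPolynomial σ ℂ) (MvPolynomial σ ℂ) :=
  ∑ j, (C (v j) : MvPolynomial σ ℂ) • pderiv j

lemma directionalDerivation_apply {σ : Type*} [Fintype σ] (v : σ → ℂ) (f : MvPolynomial σ ℂ) :
    directionalDerivation v f = ∑ j, C (v j) * pderiv j f := by
  have h := congrFun (map_sum (Derivation.coeFnAddMonoidHom (R := ℂ) (A := MvPolynomial σ ℂ)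
    (M := MvPolynomial σ ℂ)) (fun j => (C (v j) : MvPolynomial σ ℂ) • pderiv j) Finset.univ) f
  exact h.trans (by simp [Finset.sum_apply, Derivation.coeFnAddMonoidHom])

lemma directionalDerivation_X {σ : Type*} [Fintype σ] (v : σ → ℂ) (j : σ) :
    directionalDerivation v (X j) = C (v j) := by
  classical
  rw [directionalDerivation_apply, Finset.sum_eq_single j] <;>
    simp +contextual [pderiv_X, eq_comm]

variable {n s : ℕ}

/-- The point `x` of a point `(x, μ)`. -/
def pointPart (hs : 2 ≤ s) (p : Fin (s + n - 1) → ℂ) (k : Fin n) : ℂ :=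
  p ⟨k, by omega⟩

/-- The multipliers `μ` of a point `(x, μ)`, with the last one equal to `c`. -/
def multiplierPart (hs : 2 ≤ s) (c : ℂ) (p : Fin (s + n - 1) → ℂ) (j : Fin s) : ℂ :=
  if h : (j : ℕ) < s - 1 then p ⟨n + j, by omega⟩ else c

lemma sum_fin_sub_one_add {M : Type*} [AddCommMonoid M] (hs : 2 ≤ s) (f : Fin s → M) :
    ∑ j : Fin (s - 1), f ⟨j, by omega⟩ + f ⟨s - 1, by omega⟩ = ∑ j, f j := by
  obtain ⟨t, rfl⟩ : ∃ t, s = t + 1 := ⟨s - 1, by omega⟩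
  exact (Fin.sum_univ_castSucc f).symm

variable {d : ℕ} {τ : Fin s → ℤ} {a : Fin s → ℕ}

lemma eval_aeval_X {σ : Type*} (p : σ → ℂ) (j : σ) (f : Polynomial ℂ) :
    eval p (Polynomial.aeval (X j : MvPolynomial σ ℂ) f) = f.eval (p j) := by
  have h := Polynomial.aeval_algHom_apply (MvPolynomial.aeval p) (X j : MvPolynomial σ ℂ) f
  rw [MvPolynomial.aeval_X] at h
  rw [← MvPolynomial.coe_aeval_eq_eval]
  exact h.symm

lemma t2first_eq (hs : 2 ≤ s) (i : Fin s) : t2first n s hs d τ a i =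
    C ((τ i : ℤ) : ℂ) * (C (n : ℂ) + C (cauchyEntry (a i) n) +
      ∑ k : Fin n, C (cauchyEntry (a i) k) *
        Polynomial.aeval (X (⟨k, by omega⟩ : Fin (s + n - 1))) (Polynomial.Chebyshev.T ℂ d)) :=
  rfl

lemma eval_t2first (hs : 2 ≤ s) (p : Fin (s + n - 1) → ℂ) (i : Fin s) :
    eval p (t2first n s hs d τ a i) = τ i * ((n : ℂ) + cauchyEntry (a i) n +
      ∑ k : Fin n, cauchyEntry (a i) k *
        (Polynomial.Chebyshev.T ℂ d).eval (pointPart hs p k)) := by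
  simp only [t2first_eq, map_mul, map_add, map_sum, eval_C, eval_aeval_X, pointPart]

lemma derivation_t2first (hs : 2 ≤ s)
    (D : Derivation ℂ (MvPolynomial (Fin (s + n - 1)) ℂ) (MvPolynomial (Fin (s + n - 1)) ℂ))
    (i : Fin s) : D (t2first n s hs d τ a i) = C ((τ i : ℤ) : ℂ) *
      ∑ k : Fin n, C (cauchyEntry (a i) k) *
        (Polynomial.aeval (X (⟨k, by omega⟩ : Fin (s + n - 1)))
          (Polynomial.Chebyshev.T ℂ d).derivative * D (X ⟨k, by omega⟩)) := by
  simp only [t2first_eq, Derivation.leibniz, map_add, map_sum, derivation_C, add_zero,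
    zero_add, Derivation.map_aeval, smul_eq_mul, mul_zero]

lemma eval_directionalDerivation_t2first (hs : 2 ≤ s) (p v : Fin (s + n - 1) → ℂ) (i : Fin s) :
    eval p (directionalDerivation v (t2first n s hs d τ a i)) = τ i *
      ∑ k : Fin n, cauchyEntry (a i) k *
        ((Polynomial.Chebyshev.T ℂ d).derivative.eval (pointPart hs p k) * pointPart hs v k) := by
  simp only [derivation_t2first, directionalDerivation_X, map_mul, map_sum, eval_C, eval_aeval_X,
    pointPart]

lemma pderiv_t2first (hs : 2 ≤ s) (k : Fin n) (i : Fin s) :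
    pderiv (⟨k, by omega⟩ : Fin (s + n - 1)) (t2first n s hs d τ a i) =
      C (τ i * cauchyEntry (a i) k) * Polynomial.aeval (X (⟨k, by omega⟩ : Fin (s + n - 1)))
        (Polynomial.Chebyshev.T ℂ d).derivative := by
  rw [derivation_t2first, Finset.sum_eq_single k]
  · rw [pderiv_X_self, mul_one, C_mul, mul_assoc]
  · intro m _ hm
    rw [pderiv_X_of_ne (by simpa [Fin.ext_iff] using hm), mul_zero, mul_zero]
  · simp

lemma t2sec_eq (hs : 2 ≤ s) (hsn : s ≤ n - 1) (i : Fin (n - 1)) :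
    t2sec n s hs hsn d τ a i =
      (∑ j : Fin s, (if h : (j : ℕ) < s - 1 then X (⟨n + j, by omega⟩ : Fin (s + n - 1)) else 1) *
        C (τ j * cauchyEntry (a j) (i + 1))) *
      Polynomial.aeval (X (⟨i + 1, by omega⟩ : Fin (s + n - 1)))
        (Polynomial.Chebyshev.T ℂ d).derivative := by
  have h := fun j => pderiv_t2first (d := d) (τ := τ) (a := a) hs (⟨i + 1, by omega⟩ : Fin n) j
  simp only at h
  rw [Finset.sum_mul, ← sum_fin_sub_one_add hs, t2sec]
  simp only [h]
  congr 1
  · refine Finset.sum_congr rfl fun j _ => ?_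
    rw [dif_pos j.isLt, mul_assoc]
  · rw [dif_neg (by simp), one_mul]

lemma eval_t2sec (hs : 2 ≤ s) (hsn : s ≤ n - 1) (p : Fin (s + n - 1) → ℂ) (i : Fin (n - 1)) :
    eval p (t2sec n s hs hsn d τ a i) =
      (∑ j, multiplierPart hs 1 p j * τ j * cauchyEntry (a j) (i + 1)) *
        (Polynomial.Chebyshev.T ℂ d).derivative.eval (pointPart hs p ⟨i + 1, by omega⟩) := by
  rw [t2sec_eq, map_mul, eval_aeval_X, map_sum]
  congr 1
  refine Finset.sum_congr rfl fun j _ => ?_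
  rw [multiplierPart, map_mul, eval_C, mul_assoc]
  split_ifs <;> simp

lemma eval_directionalDerivation_t2sec (hs : 2 ≤ s) (hsn : s ≤ n - 1)
    (p v : Fin (s + n - 1) → ℂ) (i : Fin (n - 1)) :
    eval p (directionalDerivation v (t2sec n s hs hsn d τ a i)) =
      (∑ j, multiplierPart hs 0 v j * τ j * cauchyEntry (a j) (i + 1)) *
        (Polynomial.Chebyshev.T ℂ d).derivative.eval (pointPart hs p ⟨i + 1, by omega⟩) +
      (∑ j, multiplierPart hs 1 p j * τ j * cauchyEntry (a j) (i + 1)) *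
        ((Polynomial.Chebyshev.T ℂ d).derivative.derivative.eval
          (pointPart hs p ⟨i + 1, by omega⟩) * pointPart hs v ⟨i + 1, by omega⟩) := by
  rw [t2sec_eq, Derivation.leibniz, Derivation.map_aeval, directionalDerivation_X, map_add,
    smul_eq_mul, smul_eq_mul, smul_eq_mul, map_mul, map_mul, map_mul, eval_C, eval_aeval_X,
    eval_aeval_X, map_sum, map_sum, map_sum, add_comm]
  congr 1
  · rw [mul_comm]
    congr 1
    refine Finset.sum_congr rfl fun j _ => ?_
    rw [multiplierPart, Derivation.leibniz, derivation_C, smul_zero, zero_add, smul_eq_mul,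
      map_mul, eval_C]
    split_ifs
    · rw [directionalDerivation_X, eval_C]
      ring
    · simp
  · congr 1
    refine Finset.sum_congr rfl fun j _ => ?_
    rw [multiplierPart, map_mul, eval_C, mul_assoc]
    split_ifs <;> simp

lemma forall_typeTwoSystem_iff (hs : 2 ≤ s) (hsn : s ≤ n - 1)
    (P : MvPolynomial (Fin (s + n - 1)) ℂ → Prop) :
    (∀ i, P (typeTwoSystem n s hs hsn d τ a i)) ↔
      (∀ i, P (t2first n s hs d τ a i)) ∧ ∀ i, P (t2sec n s hs hsn d τ a i) := by
  constructor
  · intro h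
    refine ⟨fun i => ?_, fun i => ?_⟩
    · simpa [typeTwoSystem] using h ⟨i, by omega⟩
    · simpa [typeTwoSystem] using h ⟨s + i, by omega⟩
  · rintro ⟨h1, h2⟩ i
    rw [typeTwoSystem]
    split_ifs with hi
    exacts [h1 _, h2 _]

lemma forall_fin_sub_one_iff (hsn : s ≤ n - 1) (hs : 2 ≤ s) (P : Fin n → Prop) :
    (∀ i : Fin (n - 1), P ⟨i + 1, by omega⟩) ↔ ∀ k ≠ (⟨0, by omega⟩ : Fin n), P k := by
  constructor
  · intro h k hk
    have hk0 : (k : ℕ) ≠ 0 := fun h0 => hk (Fin.ext h0)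
    have := h ⟨k - 1, by omega⟩
    simpa [Nat.sub_add_cancel (Nat.one_le_iff_ne_zero.2 hk0)] using this
  · intro h i
    exact h _ (by simp [Fin.ext_iff])

lemma eval_typeTwoSystem_eq_zero_iff (hs : 2 ≤ s) (hsn : s ≤ n - 1) (hτ : ∀ i, (τ i : ℂ) ≠ 0)
    (p : Fin (s + n - 1) → ℂ) :
    (∀ i, eval p (typeTwoSystem n s hs hsn d τ a i) = 0) ↔
      CauchyRelation n a (fun k => (Polynomial.Chebyshev.T ℂ d).eval (pointPart hs p k)) ∧
      ∀ k ≠ (⟨0, by omega⟩ : Fin n),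
        (∑ j, multiplierPart hs 1 p j * τ j * cauchyEntry (a j) k) *
          (Polynomial.Chebyshev.T ℂ d).derivative.eval (pointPart hs p k) = 0 := by
  rw [forall_typeTwoSystem_iff hs hsn (fun f => eval p f = 0), ← forall_fin_sub_one_iff hsn hs]
  simp only [eval_t2first, eval_t2sec, CauchyRelation, mul_eq_zero, hτ, false_or]

lemma eval_directionalDerivation_typeTwoSystem_eq_zero_iff (hs : 2 ≤ s) (hsn : s ≤ n - 1)
    (hτ : ∀ i, (τ i : ℂ) ≠ 0) (p v : Fin (s + n - 1) → ℂ) :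
    (∀ i, eval p (directionalDerivation v (typeTwoSystem n s hs hsn d τ a i)) = 0) ↔
      (∀ i, ∑ k : Fin n, cauchyEntry (a i) k *
        ((Polynomial.Chebyshev.T ℂ d).derivative.eval (pointPart hs p k) *
          pointPart hs v k) = 0) ∧
      ∀ k ≠ (⟨0, by omega⟩ : Fin n),
        (∑ j, multiplierPart hs 0 v j * τ j * cauchyEntry (a j) k) *
          (Polynomial.Chebyshev.T ℂ d).derivative.eval (pointPart hs p k) +
        (∑ j, multiplierPart hs 1 p j * τ j * cauchyEntry (a j) k) *
          ((Polynomial.Chebyshev.T ℂ d).derivative.derivative.eval (pointPart hs p k) *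
            pointPart hs v k) = 0 := by
  rw [forall_typeTwoSystem_iff hs hsn (fun f => eval p (directionalDerivation v f) = 0),
    ← forall_fin_sub_one_iff hsn hs]
  simp only [eval_directionalDerivation_t2first, eval_directionalDerivation_t2sec, mul_eq_zero,
    hτ, false_or]

lemma eq_zero_of_parts_eq_zero (hs : 2 ≤ s) {v : Fin (s + n - 1) → ℂ} (hx : pointPart hs v = 0)
    (hm : multiplierPart hs 0 v = 0) : v = 0 := by
  ext j
  by_cases hj : (j : ℕ) < n
  · exact congrFun hx ⟨j, hj⟩
  · have h := congrFun hm ⟨j - n, by omega⟩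
    rw [multiplierPart, dif_pos (by simp only; omega)] at h
    simpa [Nat.add_sub_cancel' (not_lt.1 hj)] using h

end Evaluation

theorem statement7 (n s : ℕ) (hn : 3 ≤ n) (hs : 2 ≤ s) (hsn : s ≤ n - 1)
    (d : ℕ) (hd0 : 0 < d) (hdeven : Even d)
    (τ : Fin s → ℤ) (hτ : ∀ i, τ i = 1 ∨ τ i = -1)
    (a : Fin s → ℕ) (ha : StrictMono a)
    (haprime : (a ⟨s - 1, by omega⟩ + n + 1).Prime)
    (sols : Set (Fin (s + n - 1) → ℂ))
    (hsols : sols = {p | ∀ i, eval p (typeTwoSystem n s hs hsn d τ a i) = 0}) :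
    sols.Finite ∧
    sols.ncard = Nat.choose (n - 1) (s - 1) * d ^ s * (d - 1) ^ (n - s) ∧
    (∀ p ∈ sols, ∀ q ∈ sols, (∀ j : Fin (s + n - 1), (j : ℕ) < n → p j = q j) → p = q) ∧
    ∀ p ∈ sols,
      (Matrix.of fun i j : Fin (s + n - 1) =>
        eval p (pderiv j (typeTwoSystem n s hs hsn d τ a i))).det ≠ 0 := by
  classical
  subst hsols
  let z : Fin n := ⟨0, by omega⟩
  let j₀ : Fin s := ⟨s - 1, by omega⟩
  have hj₀ : ∀ i, a i ≤ a j₀ := fun i => ha.monotone (Fin.mk_le_mk.2 (by omega))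
  have hinj := ha.injective
  have hτsq : ∀ i, (τ i : ℂ) * τ i = 1 := fun i => by rcases hτ i with h | h <;> simp [h]
  have hτ0 : ∀ i, (τ i : ℂ) ≠ 0 := fun i h => by simpa [h] using hτsq i
  have hlast : ∀ c (p : Fin (s + n - 1) → ℂ), multiplierPart hs c p j₀ = c := fun c p => by
    simp [multiplierPart, j₀]
  simp only [eval_typeTwoSystem_eq_zero_iff hs hsn hτ0]
  set sols := {p : Fin (s + n - 1) → ℂ |
    CauchyRelation n a (fun k => (Polynomial.Chebyshev.T ℂ d).eval (pointPart hs p k)) ∧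
      ∀ k ≠ z, (∑ j, multiplierPart hs 1 p j * τ j * cauchyEntry (a j) k) *
        (Polynomial.Chebyshev.T ℂ d).derivative.eval (pointPart hs p k) = 0}
  have hl0 : ∀ p : Fin (s + n - 1) → ℂ, (fun j => multiplierPart hs 1 p j * (τ j : ℂ)) ≠ 0 := by
    intro p h
    have := congrFun h j₀
    simp [hlast, hτ0] at this
  have hnc : ∀ p ∈ sols, z ∈ noncritical d (pointPart hs p) ∧
      (noncritical d (pointPart hs p)).card = s := fun p hp =>
    mem_and_card_noncritical hd0 (by omega) hinj hj₀ haprime z hp.1 (hl0 p) hp.2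
  have hzero : ∀ p ∈ sols, ∀ k ∈ (noncritical d (pointPart hs p)).erase z,
      ∑ j, multiplierPart hs 1 p j * τ j * cauchyEntry (a j) k = 0 := fun p hp k hk =>
    (mul_eq_zero.1 (hp.2 k (Finset.ne_of_mem_erase hk))).resolve_right
      (mem_noncritical.1 (Finset.mem_of_mem_erase hk))
  have hKcard : ∀ p ∈ sols, ((noncritical d (pointPart hs p)).erase z).card + 1 = s := by
    intro p hp
    rw [Finset.card_erase_add_one (hnc p hp).1, (hnc p hp).2]
  have hsep : ∀ p ∈ sols, ∀ q ∈ sols, pointPart hs p = pointPart hs q → p = q := by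
    intro p hp q hq hpq
    have hsub : ∀ j, multiplierPart hs 0 (p - q) j =
        multiplierPart hs 1 p j - multiplierPart hs 1 q j := by
      intro j
      simp only [multiplierPart]
      split_ifs <;> simp
    have h := multiplier_eq_zero (l := fun j => multiplierPart hs 0 (p - q) j * (τ j : ℂ)) hinj
      (j₀ := j₀) (by rw [hlast, zero_mul]) (hKcard p hp).ge fun k hk => by
        simp only [hsub, sub_mul, Finset.sum_sub_distrib]
        rw [hzero p hp k hk, hzero q hq k (by rwa [← hpq]), sub_zero]
    refine sub_eq_zero.1 (eq_zero_of_parts_eq_zero hs ?_ ?_)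
    · ext k
      exact sub_eq_zero.2 (congrFun hpq k)
    · ext j
      exact (mul_eq_zero.1 (congrFun h j)).resolve_right (hτ0 j)
  have hinjOn : Set.InjOn (pointPart hs) sols := fun p hp q hq => hsep p hp q hq
  have himage : Set.image (pointPart hs) sols = {x : Fin n → ℂ |
      CauchyRelation n a (fun k => (Polynomial.Chebyshev.T ℂ d).eval (x k)) ∧
      (Polynomial.Chebyshev.T ℂ d).derivative.eval (x z) ≠ 0 ∧
      (Finset.univ.filter fun k =>
        (Polynomial.Chebyshev.T ℂ d).derivative.eval (x k) ≠ 0).card = s} := by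
    ext x
    constructor
    · rintro ⟨p, hp, rfl⟩
      exact ⟨hp.1, mem_noncritical.1 (hnc p hp).1, (hnc p hp).2⟩
    · rintro ⟨hrel, hz, hcard⟩
      have hz' : z ∈ noncritical d x := mem_noncritical.2 hz
      obtain ⟨l, hl, hlK⟩ := exists_multiplier (K := (noncritical d x).erase z) hinj j₀
        (by rw [Finset.card_erase_add_one hz']; exact hcard)
      let p : Fin (s + n - 1) → ℂ := fun j =>
        if h : (j : ℕ) < n then x ⟨j, h⟩ else l ⟨j - n, by omega⟩ * τ ⟨j - n, by omega⟩ * τ j₀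
      have hpx : pointPart hs p = x := by
        ext k
        simp [pointPart, p]
      have hpl : ∀ j, multiplierPart hs 1 p j * τ j = l j * τ j₀ := by
        intro j
        by_cases hj : (j : ℕ) < s - 1
        · simp only [multiplierPart, dif_pos hj, p]
          rw [dif_neg (by omega)]
          simp only [Nat.add_sub_cancel_left, Fin.eta]
          linear_combination l j * τ j₀ * hτsq j
        · obtain rfl : j = j₀ := Fin.ext (by simp only [j₀]; omega)
          rw [hlast, hl]
      refine ⟨p, ⟨by rwa [hpx], fun k hk => ?_⟩, hpx⟩
      simp only [hpl, hpx]
      by_cases hkx : k ∈ noncritical d x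
      · have := hlK k (Finset.mem_erase.2 ⟨hk, hkx⟩)
        rw [Finset.sum_congr rfl fun j _ => mul_right_comm (l j) _ _, ← Finset.sum_mul, this,
          zero_mul, zero_mul]
      · rw [not_not.1 (mt mem_noncritical.2 hkx), mul_zero]
  obtain ⟨hfin, hncard⟩ := ncard_critical_set hd0 (show 0 < s by omega) z
    (fun u hu => CauchyRelation.card_le hinj hj₀ haprime hu (by omega))
    (fun S hS => CauchyRelation.exists_eqOn_compl hinj hS)
    (fun S hS u v => CauchyRelation.eq_of_eqOn_compl hinj hS)
  rw [← himage] at hfin hncard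
  refine ⟨Set.Finite.of_finite_image hfin hinjOn, ?_, ?_, ?_⟩
  · rw [← hncard, hinjOn.ncard_image]
  · exact fun p hp q hq h => hsep p hp q hq (funext fun k => h _ k.isLt)
  intro p hp hdet
  obtain ⟨v, hv0, hv⟩ := Matrix.exists_mulVec_eq_zero_iff.2 hdet
  refine hv0 ?_
  obtain ⟨hv1, hv2⟩ := (eval_directionalDerivation_typeTwoSystem_eq_zero_iff (d := d) (a := a)
    hs hsn hτ0 p v).1
    fun i => by
      rw [directionalDerivation_apply, map_sum]
      refine Eq.trans ?_ (congrFun hv i)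
      simp [Matrix.mulVec, dotProduct, mul_comm]
  obtain ⟨hz, hcard⟩ := hnc p hp
  have hcrit : ∀ k ∉ noncritical d (pointPart hs p), pointPart hs v k = 0 := by
    intro k hk
    have hkz : k ≠ z := fun h => hk (h ▸ hz)
    have hT' := not_not.1 (mt mem_noncritical.2 hk)
    have h := hv2 k hkz
    rw [hT', mul_zero, zero_add, mul_eq_zero, mul_eq_zero] at h
    rcases h with h | h | h
    · have hlt := card_lt_of_sum_mul_cauchyEntry_eq_zero hinj (hl0 p)
        (K := insert k ((noncritical d (pointPart hs p)).erase z)) fun m hm => by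
          rcases Finset.mem_insert.1 hm with rfl | hm
          exacts [h, hzero p hp m hm]
      rw [Finset.card_insert_of_notMem fun h => hk (Finset.mem_of_mem_erase h), hKcard p hp] at hlt
      exact absurd hlt (lt_irrefl s)
    · exact absurd h (eval_derivative_derivative_T_ne_zero hd0 hT')
    · exact h
  have hpoint : pointPart hs v = 0 := by
    have h := eq_zero_of_sum_cauchyEntry_mul_eq_zero hinj hcard.le
      (y := fun k => (Polynomial.Chebyshev.T ℂ d).derivative.eval (pointPart hs p k) *
        pointPart hs v k) (fun k hk => by rw [hcrit k hk, mul_zero]) hv1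
    ext k
    by_cases hk : k ∈ noncritical d (pointPart hs p)
    · exact (mul_eq_zero.1 (congrFun h k)).resolve_left (mem_noncritical.1 hk)
    · exact hcrit k hk
  refine eq_zero_of_parts_eq_zero hs hpoint ?_
  have h := multiplier_eq_zero (l := fun j => multiplierPart hs 0 v j * (τ j : ℂ)) hinj
    (j₀ := j₀) (by rw [hlast, zero_mul]) (hKcard p hp).ge fun k hk => by
      have h := hv2 k (Finset.ne_of_mem_erase hk)
      rw [hpoint, Pi.zero_apply, mul_zero, mul_zero, add_zero] at h
      exact (mul_eq_zero.1 h).resolve_right (mem_noncritical.1 (Finset.mem_of_mem_erase hk))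
  ext j
  exact (mul_eq_zero.1 (congrFun h j)).resolve_right (hτ0 j)
end

section
/- Let f_1,…,f_m ∈ ℝ[x_1,…,x_n], let d be an even positive integer with d ≥ deg f_i for all i, and let T be the Chebyshev polynomial of the first kind of degree d. Let q_1 < … < q_m be the m smallest prime numbers greater than n. For 1 ≤ i ≤ m define g_i^+(x) = n + 1/q_i + ∑_{k=1}^{n} T(x_k)/(q_i − n − 1 + k) and g_i^−(x) = −g_i^+(x), and set F_i^±(t,x) = (1−t) f_i(x) + t g_i^±(x). Then for every subset S = {i_1,…,i_s} ⊆ {1,…,m} with s > n and every τ ∈ {+,−}^s, the set {t ∈ ℂ : there exists x ∈ ℂⁿ with F_{i_1}^{τ_1}(t,x) = … = F_{i_s}^{τ_s}(t,x) = 0} is finite (possibly empty). -/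
open MvPolynomial

/-- Evaluation of the Chebyshev polynomial of the first kind of degree `d` at a
complex number. -/
noncomputable def chebEval (d : ℕ) (z : ℂ) : ℂ :=
  Polynomial.eval z (Polynomial.Chebyshev.T ℂ d)

/-- `g_i^+(x) = n + 1/q_i + ∑_{k=1}^n T(x_k)/(q_i - n - 1 + k)`. -/
noncomputable def gplus (n : ℕ) (d : ℕ) (q : ℕ) (x : Fin n → ℂ) : ℂ :=
  (n : ℂ) + ((q : ℂ))⁻¹ +
    ∑ k : Fin n, (((q - n - 1 + ((k : ℕ) + 1) : ℕ) : ℂ))⁻¹ * chebEval d (x k)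

/-- The polynomials `∑ i ∈ S, a i * H i` whose coefficients `a i` have total degree at most `K`. -/
noncomputable def boundedCombinations {σ ι 𝕜 : Type*} [Field 𝕜] (S : Finset ι)
    (H : ι → MvPolynomial σ 𝕜) (K : ℕ) : Submodule 𝕜 (MvPolynomial σ 𝕜) :=
  (Submodule.pi Set.univ fun _ : ι => restrictTotalDegree σ 𝕜 K).map
    (∑ i ∈ S, LinearMap.mulRight 𝕜 (H i) ∘ₗ LinearMap.proj i)

theorem mem_boundedCombinations {σ ι 𝕜 : Type*} [Field 𝕜] {S : Finset ι}
    {H : ι → MvPolynomial σ 𝕜} {K : ℕ} {w : MvPolynomial σ 𝕜} :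
    w ∈ boundedCombinations S H K ↔
      ∃ a : ι → MvPolynomial σ 𝕜, (∀ i, (a i).totalDegree ≤ K) ∧ ∑ i ∈ S, a i * H i = w := by
  simp [boundedCombinations, Submodule.mem_pi, mem_restrictTotalDegree]

/-- If the `H i` generate all polynomials of degree at most `K + d` with coefficients of degree at
most `K`, then the pencil `(1 - t) P + t H` has a common zero for only finitely many `t`. -/
theorem finite_setOf_pencil_common_zero {σ ι 𝕜 : Type*} [Finite σ] [Field 𝕜] {S : Finset ι}
    {P H : ι → MvPolynomial σ 𝕜} {K d : ℕ} (hP : ∀ i, (P i).totalDegree ≤ d)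
    (hH : restrictTotalDegree σ 𝕜 (K + d) ≤ boundedCombinations S H K) :
    {t : 𝕜 | ∃ x : σ → 𝕜, ∀ i ∈ S, (1 - t) * eval x (P i) + t * eval x (H i) = 0}.Finite := by
  let W := restrictTotalDegree σ 𝕜 (K + d)
  let b := Module.finBasis 𝕜 W
  choose a ha hsum using fun j => mem_boundedCombinations.1 (hH (b j).2)
  have hmem (j) : ∑ i ∈ S, a j i * P i ∈ W :=
    Submodule.sum_mem _ fun i _ => (mem_restrictTotalDegree _ _ _).2
      ((totalDegree_mul _ _).trans (add_le_add (ha j i) (hP i)))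
  let B : Module.End 𝕜 W := b.constr 𝕜 fun j => ⟨_, hmem j⟩
  let ev (x : σ → 𝕜) : W →ₗ[𝕜] 𝕜 := (aeval x).toLinearMap ∘ₗ W.subtype
  have hone : (1 : MvPolynomial σ 𝕜) ∈ W := (mem_restrictTotalDegree _ _ _).2 (by simp)
  have hev (x : σ → 𝕜) : ev x ⟨1, hone⟩ = 1 := by simp [ev]
  have key {t : 𝕜} {x : σ → 𝕜}
      (hx : ∀ i ∈ S, (1 - t) * eval x (P i) + t * eval x (H i) = 0) :
      ev x ∘ₗ (t • LinearMap.id + (1 - t) • B) = 0 := by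
    refine b.ext fun j => ?_
    have : ev x (b j) = ∑ i ∈ S, eval x (a j i) * eval x (H i) := by
      simp [ev, ← hsum j, aeval_eq_eval]
    have h2 : ev x (B (b j)) = ∑ i ∈ S, eval x (a j i) * eval x (P i) := by
      simp [ev, B, aeval_eq_eval]
    simp only [LinearMap.comp_apply, LinearMap.add_apply, LinearMap.smul_apply, LinearMap.id_apply,
      map_add, map_smul, this, h2, smul_eq_mul, Finset.mul_sum, ← Finset.sum_add_distrib,
      LinearMap.zero_apply]
    refine Finset.sum_eq_zero fun i hi => ?_
    linear_combination eval x (a j i) * hx i hi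
  have hne {t : 𝕜} {x : σ → 𝕜}
      (hx : ∀ i ∈ S, (1 - t) * eval x (P i) + t * eval x (H i) = 0) : t ≠ 1 := by
    rintro rfl
    simpa [hev] using LinearMap.congr_fun (key hx) ⟨1, hone⟩
  refine Set.Finite.of_finite_image (f := fun t => t / (t - 1))
    (B.finite_hasEigenvalue.subset ?_) ?_
  · rintro _ ⟨t, ⟨x, hx⟩, rfl⟩
    have ht : t - 1 ≠ 0 := sub_ne_zero.2 (hne hx)
    by_contra hno
    have hinj : Function.Injective (B - (t / (t - 1)) • (1 : Module.End 𝕜 W)) := by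
      rw [← LinearMap.ker_eq_bot, ← Module.End.eigenspace_def]
      simpa [Module.End.hasEigenvalue_iff] using hno
    obtain ⟨w, hw⟩ := LinearMap.injective_iff_surjective.1 hinj ⟨1, hone⟩
    have h1 := congrArg (ev x) hw
    have h2 := LinearMap.congr_fun (key hx) w
    simp only [LinearMap.sub_apply, LinearMap.smul_apply, Module.End.one_apply, map_sub, map_smul,
      hev, smul_eq_mul, LinearMap.comp_apply, LinearMap.add_apply, LinearMap.id_apply, map_add,
      LinearMap.zero_apply] at h1 h2
    field_simp at h1
    exact ht (by linear_combination -h1 - h2)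
  · rintro t ⟨x, hx⟩ u ⟨y, hy⟩ htu
    have ht : t - 1 ≠ 0 := sub_ne_zero.2 (hne hx)
    have hu : u - 1 ≠ 0 := sub_ne_zero.2 (hne hy)
    simp only at htu
    rw [div_eq_div_iff ht hu] at htu
    linear_combination -htu

theorem totalDegree_aeval_X_le {σ 𝕜 : Type*} [CommSemiring 𝕜] (p : Polynomial 𝕜) (k : σ) :
    (Polynomial.aeval (X k : MvPolynomial σ 𝕜) p).totalDegree ≤ p.natDegree := by
  rw [Polynomial.aeval_eq_sum_range]
  refine totalDegree_finsetSum_le fun i hi => (totalDegree_smul_le _ _).trans ?_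
  rw [X_pow_eq_monomial]
  refine (totalDegree_monomial_le _ _).trans ?_
  simpa [Finsupp.sum_single_index] using Finset.mem_range_succ_iff.1 hi

/-- Division by the univariate polynomials `T (X k)` in top degree. -/
theorem restrictTotalDegree_le_of_aeval_X_mul_mem {n d K : ℕ} {𝕜 : Type*} [Field 𝕜]
    {T : Polynomial 𝕜} (hT : T.natDegree = d) (hd : 0 < d) (hK : n * d ≤ K)
    {M : Submodule 𝕜 (MvPolynomial (Fin n) 𝕜)} (hM : restrictTotalDegree (Fin n) 𝕜 K ≤ M)
    (hTM : ∀ a ∈ restrictTotalDegree (Fin n) 𝕜 K, ∀ k, a * Polynomial.aeval (X k) T ∈ M)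
    {j : ℕ} (hj : j ≤ K + d) : restrictTotalDegree (Fin n) 𝕜 j ≤ M := by
  induction j with
  | zero =>
    exact le_trans (fun p hp => by
      rw [mem_restrictTotalDegree] at hp ⊢
      omega) hM
  | succ j ih =>
    have ih := ih (by omega)
    intro p hp
    rw [mem_restrictTotalDegree] at hp
    rw [p.as_sum]
    refine M.sum_mem fun α hα => ?_
    have hαj : α.sum (fun _ e => e) ≤ j + 1 := (le_totalDegree hα).trans hp
    generalize coeff α p = c
    by_cases hαK : α.sum (fun _ e => e) ≤ K
    · exact hM ((mem_restrictTotalDegree _ _ _).2 ((totalDegree_monomial_le _ _).trans hαK))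
    obtain ⟨k, hk⟩ : ∃ k, d ≤ α k := by
      by_contra! h
      apply hαK
      rw [Finsupp.sum_fintype _ _ (fun _ => rfl)]
      calc ∑ k, α k ≤ ∑ _k : Fin n, d := Finset.sum_le_sum fun k _ => (h k).le
        _ ≤ K := by simpa using hK
    obtain ⟨β, rfl⟩ : ∃ β, α = β + Finsupp.single k d :=
      ⟨α - Finsupp.single k d, (tsub_add_cancel_of_le (by simpa using hk)).symm⟩
    rw [Finsupp.sum_add_index' (fun _ => rfl) (fun _ _ _ => rfl),
      Finsupp.sum_single_index rfl] at hαj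
    have hlead : T.leadingCoeff ≠ 0 := by
      rw [Polynomial.leadingCoeff_ne_zero]
      rintro rfl
      simp at hT
      omega
    have hβ : (monomial β (c / T.leadingCoeff)).totalDegree ≤ β.sum fun _ e => e :=
      totalDegree_monomial_le _ _
    have hsplit : monomial (β + Finsupp.single k d) c =
        monomial β (c / T.leadingCoeff) * Polynomial.aeval (X k) T -
          monomial β (c / T.leadingCoeff) * Polynomial.aeval (X k) T.eraseLead := by
      have hTX := congrArg (Polynomial.aeval (X k : MvPolynomial (Fin n) 𝕜))
        T.eraseLead_add_C_mul_X_pow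
      rw [← hTX, map_add, mul_add, add_sub_cancel_left, hT]
      simp only [map_mul, map_pow, Polynomial.aeval_C, Polynomial.aeval_X, algebraMap_eq,
        X_pow_eq_monomial, C_mul_monomial, monomial_mul, mul_one]
      rw [div_mul_cancel₀ _ hlead]
    rw [hsplit]
    refine M.sub_mem (hTM _ ((mem_restrictTotalDegree _ _ _).2 ?_) _)
      (ih ((mem_restrictTotalDegree _ _ _).2 ?_))
    · exact hβ.trans (by omega)
    · have h1 := totalDegree_aeval_X_le T.eraseLead k
      have h2 := T.eraseLead_natDegree_le
      refine (totalDegree_mul _ _).trans ?_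
      omega

/-- The coefficients of `gplus n d q` with respect to `1, T (x 0), …, T (x (n - 1))`. -/
noncomputable def gplusCoeffs (n q : ℕ) : ℂ × (Fin n → ℂ) :=
  ((n : ℂ) + (q : ℂ)⁻¹, fun k => (((q - n - 1 + ((k : ℕ) + 1) : ℕ) : ℂ))⁻¹)

/-- Clearing denominators: if `y * (c + 1/x) + ∑ k, z k / (x - b k)` vanishes at `n + 1` points,
then its numerator is determined by its leading coefficient `y * c` and these zeros. -/
theorem numerator_eq_zero_of_partialFractions {n : ℕ} {F : Type*} [Field F] {b : Fin n → F}
    {s : Finset F} (hs : s.card = n + 1) (h0 : ∀ x ∈ s, x ≠ 0) (hb : ∀ x ∈ s, ∀ k, x ≠ b k)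
    {c y : F} {z : Fin n → F}
    (h : ∀ x ∈ s, y * (c + x⁻¹) + ∑ k, z k * (x - b k)⁻¹ = 0) :
    (y * c) • (Polynomial.X * ∏ k, (Polynomial.X - Polynomial.C (b k)) -
        ∏ x ∈ s, (Polynomial.X - Polynomial.C x)) +
      y • ∏ k, (Polynomial.X - Polynomial.C (b k)) +
      ∑ k, z k • (Polynomial.X * ∏ l ∈ Finset.univ.erase k, (Polynomial.X - Polynomial.C (b l))) =
        0 := by
  have hDE (k) : (Polynomial.X - Polynomial.C (b k)) *
      ∏ l ∈ Finset.univ.erase k, (Polynomial.X - Polynomial.C (b l)) =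
        ∏ k, (Polynomial.X - Polynomial.C (b k)) :=
    Finset.mul_prod_erase _ (fun k => Polynomial.X - Polynomial.C (b k)) (Finset.mem_univ k)
  have hQ (x) (hx : x ∈ s) :
      (∏ x ∈ s, (Polynomial.X - Polynomial.C x)).eval x = 0 := by
    simp only [Polynomial.eval_prod, Polynomial.eval_sub, Polynomial.eval_X, Polynomial.eval_C]
    exact Finset.prod_eq_zero hx (sub_self _)
  have hE (k) : (∏ l ∈ Finset.univ.erase k, (Polynomial.X - Polynomial.C (b l))).Monic :=
    Polynomial.monic_prod_X_sub_C _ _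
  have hEd (k) : (∏ l ∈ Finset.univ.erase k, (Polynomial.X - Polynomial.C (b l))).natDegree =
      n - 1 := by
    simp
  have hDm : (∏ k, (Polynomial.X - Polynomial.C (b k))).Monic := Polynomial.monic_prod_X_sub_C _ _
  have hQm : (∏ x ∈ s, (Polynomial.X - Polynomial.C x)).Monic := Polynomial.monic_prod_X_sub_C _ _
  have hDd : (∏ k, (Polynomial.X - Polynomial.C (b k))).natDegree = n := by simp
  have hQd : (∏ x ∈ s, (Polynomial.X - Polynomial.C x)).natDegree = n + 1 := by simp [hs]
  generalize ∏ k, (Polynomial.X - Polynomial.C (b k)) = D at *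
  generalize ∏ x ∈ s, (Polynomial.X - Polynomial.C x) = Q at *
  refine Polynomial.eq_zero_of_degree_lt_of_eval_finset_eq_zero s ?_ fun x hx => ?_
  · rw [hs, ← Polynomial.mem_degreeLT]
    refine Submodule.add_mem _ (Submodule.add_mem _ (Submodule.smul_mem _ _ ?_)
      (Submodule.smul_mem _ _ ?_)) (Submodule.sum_mem _ fun k _ => Submodule.smul_mem _ _ ?_)
    · have hXD : (Polynomial.X * D).natDegree = n + 1 := by
        rw [Polynomial.monic_X.natDegree_mul hDm, hDd, Polynomial.natDegree_X, add_comm]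
      have hdeg : (Polynomial.X * D).degree = ((n + 1 : ℕ) : WithBot ℕ) := by
        rw [Polynomial.degree_eq_natDegree (Polynomial.monic_X.mul hDm).ne_zero, hXD]
      rw [Polynomial.mem_degreeLT, ← hdeg]
      refine Polynomial.degree_sub_lt_left ?_ (Polynomial.monic_X.mul hDm).ne_zero ?_
      · rw [hdeg, Polynomial.degree_eq_natDegree hQm.ne_zero, hQd]
      · rw [(Polynomial.monic_X.mul hDm).leadingCoeff, hQm.leadingCoeff]
    · rw [Polynomial.mem_degreeLT, Polynomial.degree_eq_natDegree hDm.ne_zero, hDd]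
      exact_mod_cast n.lt_succ_self
    · have hk := k.pos
      rw [Polynomial.mem_degreeLT,
        Polynomial.degree_eq_natDegree (Polynomial.monic_X.mul (hE k)).ne_zero,
        Polynomial.monic_X.natDegree_mul (hE k), Polynomial.natDegree_X, hEd, Nat.cast_lt]
      omega
  · have hEx (k) : (∏ l ∈ Finset.univ.erase k, (Polynomial.X - Polynomial.C (b l))).eval x =
        (x - b k)⁻¹ * D.eval x := by
      rw [← hDE k, Polynomial.eval_mul, Polynomial.eval_sub, Polynomial.eval_X, Polynomial.eval_C,
        inv_mul_cancel_left₀ (sub_ne_zero.2 (hb x hx k))]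
    have hsum : ∑ k, z k * (x * ((x - b k)⁻¹ * D.eval x)) =
        x * D.eval x * ∑ k, z k * (x - b k)⁻¹ := by
      rw [Finset.mul_sum]
      exact Finset.sum_congr rfl fun k _ => by ring
    simp only [Polynomial.eval_add, Polynomial.eval_smul, Polynomial.eval_sub, Polynomial.eval_mul,
      Polynomial.eval_X, Polynomial.eval_finsetSum, hQ x hx, hEx, smul_eq_mul, hsum]
    linear_combination x * D.eval x * h x hx - y * D.eval x * mul_inv_cancel₀ (h0 x hx)

/-- A function `y * (c + 1/x) + ∑ k, z k / (x - b k)` that vanishes at `n + 1` points is zero,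
unless these points satisfy an exceptional product relation. -/
theorem eq_zero_of_partialFractions {n : ℕ} {F : Type*} [Field F] {b : Fin n → F}
    (hb0 : ∀ k, b k ≠ 0) (hbinj : Function.Injective b) {s : Finset F} (hs : s.card = n + 1)
    (h0 : ∀ x ∈ s, x ≠ 0) (hb : ∀ x ∈ s, ∀ k, x ≠ b k) {c y : F} {z : Fin n → F}
    (hc : ∏ k, -b k ≠ c * ∏ x ∈ s, -x)
    (h : ∀ x ∈ s, y * (c + x⁻¹) + ∑ k, z k * (x - b k)⁻¹ = 0) : y = 0 ∧ z = 0 := by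
  have hR := numerator_eq_zero_of_partialFractions hs h0 hb h
  have hy : y = 0 := by
    have h0 := congrArg (Polynomial.eval 0) hR
    simp only [Polynomial.eval_add, Polynomial.eval_smul, Polynomial.eval_sub, Polynomial.eval_mul,
      Polynomial.eval_X, Polynomial.eval_finsetSum, Polynomial.eval_prod, Polynomial.eval_C,
      smul_eq_mul, zero_mul, mul_zero, Finset.sum_const_zero, add_zero, Polynomial.eval_zero,
      zero_sub] at h0
    refine (mul_eq_zero.1 ?_).resolve_right (sub_ne_zero.2 hc)
    linear_combination h0
  refine ⟨hy, funext fun k => ?_⟩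
  have hk := congrArg (Polynomial.eval (b k)) hR
  simp only [hy, zero_mul, zero_smul, zero_add, Polynomial.eval_finsetSum, Polynomial.eval_smul,
    Polynomial.eval_mul, Polynomial.eval_X, Polynomial.eval_prod, Polynomial.eval_sub,
    Polynomial.eval_C, smul_eq_mul, Polynomial.eval_zero] at hk
  rw [Finset.sum_eq_single k] at hk
  · have hEk : ∏ l ∈ Finset.univ.erase k, (b k - b l) ≠ 0 :=
      Finset.prod_ne_zero_iff.2 fun l hl =>
        sub_ne_zero.2 (hbinj.ne (Finset.ne_of_mem_erase hl).symm)
    exact (mul_eq_zero.1 hk).resolve_right (mul_ne_zero (hb0 k) hEk)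
  · intro l _ hl
    rw [Finset.prod_eq_zero (Finset.mem_erase.2 ⟨hl.symm, Finset.mem_univ k⟩) (sub_self _),
      mul_zero, mul_zero]
  · simp

theorem eq_zero_of_gplusCoeffs {n : ℕ} (hn : 0 < n) {s : Finset ℕ} (hs : s.card = n + 1)
    (hsn : ∀ q ∈ s, n < q) (y : ℂ) (z : Fin n → ℂ)
    (h : ∀ q ∈ s, y * (gplusCoeffs n q).1 + ∑ k, z k * (gplusCoeffs n q).2 k = 0) :
    y = 0 ∧ z = 0 := by
  refine eq_zero_of_partialFractions (b := fun k => ((n - k : ℕ) : ℂ)) (c := n)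
    (s := s.map Nat.castEmbedding) ?_ ?_ (by rwa [Finset.card_map]) ?_ ?_ ?_ ?_
  · intro k
    rw [Nat.cast_ne_zero]
    omega
  · intro k l hkl
    have : n - (k : ℕ) = n - l := Nat.cast_injective hkl
    ext
    omega
  · simp only [Finset.forall_mem_map, Nat.castEmbedding_apply]
    intro q hq
    have := hsn q hq
    rw [Nat.cast_ne_zero]
    omega
  · simp only [Finset.forall_mem_map, Nat.castEmbedding_apply]
    intro q hq k
    have := hsn q hq
    rw [Ne, Nat.cast_inj]
    omega
  · have hD : ∏ k : Fin n, -((n - k : ℕ) : ℂ) = (-1) ^ n * ((∏ k : Fin n, (n - k) : ℕ) : ℂ) := by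
      rw [Finset.prod_neg, Finset.card_univ, Fintype.card_fin, Nat.cast_prod]
    have hQ : ∏ x ∈ s.map Nat.castEmbedding, -(x : ℂ) =
        (-1) ^ (n + 1) * ((∏ q ∈ s, q : ℕ) : ℂ) := by
      simp [Finset.prod_neg, hs]
    intro hc
    rw [hD, hQ] at hc
    have hsum : (((∏ k : Fin n, (n - k)) + n * ∏ q ∈ s, q : ℕ) : ℂ) = 0 := by
      refine (mul_eq_zero.1 ?_).resolve_left (pow_ne_zero n (neg_ne_zero.2 (one_ne_zero (α := ℂ))))
      rw [Nat.cast_add, Nat.cast_mul]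
      linear_combination hc
    have hpos : 0 < n * ∏ q ∈ s, q :=
      Nat.mul_pos hn (Finset.prod_pos fun q hq => (Nat.zero_le _).trans_lt (hsn q hq))
    rw [Nat.cast_eq_zero] at hsum
    omega
  · simp only [Finset.forall_mem_map, Nat.castEmbedding_apply]
    intro q hq
    have hqb (k : Fin n) : ((q - n - 1 + ((k : ℕ) + 1) : ℕ) : ℂ) = q - ((n - k : ℕ) : ℂ) := by
      have := hsn q hq
      rw [← Nat.cast_sub (by omega)]
      congr 1
      omega
    have hq' := h q hq
    simp only [gplusCoeffs, hqb] at hq'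
    exact hq'

theorem span_gplusCoeffs_eq_top {n : ℕ} (hn : 0 < n) {ι : Type*} {S : Finset ι} {q : ι → ℕ}
    (hq : Function.Injective q) (hqn : ∀ i, n < q i) (hS : n < S.card) {ε : ι → ℂ}
    (hε : ∀ i, ε i ≠ 0) :
    Submodule.span ℂ ((fun i => ε i • gplusCoeffs n (q i)) '' S) = ⊤ := by
  by_contra hne
  obtain ⟨φ, hφ, hle⟩ := Submodule.exists_le_ker_of_lt_top _ (lt_top_iff_ne_top.2 hne)
  obtain ⟨S', hS'S, hS'⟩ := Finset.exists_subset_card_eq (Nat.succ_le_of_lt hS)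
  have hφv (v : ℂ × (Fin n → ℂ)) :
      φ v = φ (1, 0) * v.1 + ∑ k, φ (0, Pi.single k 1) * v.2 k := by
    have hv : v = v.1 • ((1 : ℂ), (0 : Fin n → ℂ)) +
        ∑ k, v.2 k • ((0 : ℂ), (Pi.single k 1 : Fin n → ℂ)) := by
      ext l
      · simp [Prod.fst_sum]
      · simp [Prod.snd_sum, Finset.sum_apply, Pi.single_apply]
    conv_lhs => rw [hv]
    simp only [map_add, map_sum, map_smul, smul_eq_mul, mul_comm]
  obtain ⟨hy, hz⟩ := eq_zero_of_gplusCoeffs hn (s := S'.map ⟨q, hq⟩) (by simpa using hS')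
    (by simpa using fun i _ => hqn i) (φ (1, 0)) (fun k => φ (0, Pi.single k 1)) (by
      simp only [Finset.mem_map, Function.Embedding.coeFn_mk, forall_exists_index, and_imp,
        forall_apply_eq_imp_iff₂]
      intro i hi
      rw [← hφv]
      have := hle (Submodule.subset_span ⟨i, hS'S hi, rfl⟩)
      simpa [hε i] using this)
  refine hφ (LinearMap.ext fun v => ?_)
  rw [hφv, hy]
  simp [funext_iff.1 hz]

/-- The polynomial with coordinates `v` with respect to `1, T (X 0), …, T (X (n - 1))`. -/
noncomputable def affineCombination {n : ℕ} (T : Polynomial ℂ) :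
    ℂ × (Fin n → ℂ) →ₗ[ℂ] MvPolynomial (Fin n) ℂ :=
  (Algebra.linearMap ℂ _).coprod (Fintype.linearCombination ℂ fun k => Polynomial.aeval (X k) T)

theorem affineCombination_one_zero {n : ℕ} (T : Polynomial ℂ) :
    affineCombination T ((1 : ℂ), (0 : Fin n → ℂ)) = 1 := by
  simp [affineCombination]

theorem affineCombination_zero_single {n : ℕ} (T : Polynomial ℂ) (k : Fin n) :
    affineCombination T ((0 : ℂ), Pi.single k (1 : ℂ)) = Polynomial.aeval (X k) T := by
  simp [affineCombination]

theorem eval_affineCombination_gplusCoeffs {n d q : ℕ} (x : Fin n → ℂ) :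
    eval x (affineCombination (Polynomial.Chebyshev.T ℂ d) (gplusCoeffs n q)) =
      gplus n d q x := by
  have hT (k : Fin n) (T : Polynomial ℂ) :
      eval x (Polynomial.aeval (X k : MvPolynomial (Fin n) ℂ) T) = T.eval (x k) := by
    rw [← coe_aeval_eq_eval, RingHom.coe_coe, ← Polynomial.aeval_algHom_apply, aeval_X,
      Polynomial.coe_aeval_eq_eval]
  unfold gplus chebEval
  generalize Polynomial.Chebyshev.T ℂ d = T
  simp [affineCombination, gplusCoeffs, Fintype.linearCombination_apply,
    smul_eval, hT, algebraMap_eq]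

theorem mul_affineCombination_mem_boundedCombinations {n K : ℕ} {ι : Type*} {S : Finset ι}
    {u : ι → ℂ × (Fin n → ℂ)} (hu : Submodule.span ℂ (u '' S) = ⊤) (T : Polynomial ℂ)
    {a : MvPolynomial (Fin n) ℂ} (ha : a ∈ restrictTotalDegree (Fin n) ℂ K)
    (v : ℂ × (Fin n → ℂ)) :
    a * affineCombination T v ∈ boundedCombinations S (fun i => affineCombination T (u i)) K := by
  obtain ⟨c, rfl⟩ := (Submodule.mem_span_image_finset_iff_exists_fun' ℂ).1
    (hu ▸ Submodule.mem_top : v ∈ Submodule.span ℂ (u '' S))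
  refine mem_boundedCombinations.2 ⟨fun i => c i • a, fun i =>
    (totalDegree_smul_le _ _).trans ((mem_restrictTotalDegree _ _ _).1 ha), ?_⟩
  simp [map_sum, Finset.mul_sum]

theorem statement8 (n m : ℕ) (hn : 0 < n) (f : Fin m → MvPolynomial (Fin n) ℝ)
    (d : ℕ) (hd0 : 0 < d) (hdeven : Even d) (hdeg : ∀ i, (f i).totalDegree ≤ d)
    (q : Fin m → ℕ) (hqmono : StrictMono q)
    (hqprime : ∀ i, (q i).Prime) (hqn : ∀ i, n < q i)
    -- `q` lists the `m` smallest primes greater than `n`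
    (hqsmall : ∀ i : Fin m, ∀ p : ℕ, p.Prime → n < p → p < q i → ∃ j : Fin m, q j = p) :
    ∀ S : Finset (Fin m), n < S.card → ∀ τ : Fin m → Bool,
      {t : ℂ | ∃ x : Fin n → ℂ, ∀ i ∈ S,
        (1 - t) * eval x ((f i).map (algebraMap ℝ ℂ)) +
          t * (if τ i then gplus n d (q i) x else -gplus n d (q i) x) = 0}.Finite := by
  intro S hS τ
  let ε : Fin m → ℂ := fun i => if τ i then 1 else -1
  have hε (i) : ε i ≠ 0 := by
    simp only [ε]
    split_ifs <;> simp
  let T := Polynomial.Chebyshev.T ℂ d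
  let u : Fin m → ℂ × (Fin n → ℂ) := fun i => ε i • gplusCoeffs n (q i)
  have hmem {a : MvPolynomial (Fin n) ℂ} (ha : a ∈ restrictTotalDegree (Fin n) ℂ (n * d))
      (v : ℂ × (Fin n → ℂ)) :=
    mul_affineCombination_mem_boundedCombinations
      (span_gplusCoeffs_eq_top hn hqmono.injective hqn hS hε) T ha v
  have hH : restrictTotalDegree (Fin n) ℂ (n * d + d) ≤
      boundedCombinations S (fun i => affineCombination T (u i)) (n * d) := by
    refine restrictTotalDegree_le_of_aeval_X_mul_mem (T := T) (K := n * d)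
      (by simp [T, Polynomial.Chebyshev.natDegree_T]) hd0 le_rfl
      (fun a ha => ?_) (fun a ha k => ?_) le_rfl
    · simpa only [affineCombination_one_zero, mul_one] using hmem ha (1, 0)
    · simpa only [affineCombination_zero_single] using hmem ha (0, Pi.single k 1)
  refine (finite_setOf_pencil_common_zero (P := fun i => (f i).map (algebraMap ℝ ℂ))
    (fun i => (Finset.sup_mono (support_map_subset _ _)).trans (hdeg i)) hH).subset ?_
  rintro t ⟨x, hx⟩
  refine ⟨x, fun i hi => ?_⟩
  rw [← hx i hi, map_smul, smul_eval, eval_affineCombination_gplusCoeffs]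
  by_cases hτ : τ i <;> simp [ε, hτ]
end
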